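/- arXiv:math/0101061 — 2 statements merged into one kernel-verified Lean document; each statement's English description precedes it below -/
import Mathlib

section
/- Let (X1, X2) be a regular bipartition of the 2-torus T^2, i.e. X1, X2 are disjoint open subsets with common boundary ∂X1 = ∂X2 a smooth closed 1-manifold, and T^2 = X1 ∪ X2 ∪ ∂X1. Then exactly one of the following holds: (i) the inclusion X1 → T^2 induces the trivial map π_1(X1) → π_1(T^2); (ii) the inclusion X2 → T^2 induces the trivial map π_1(X2) → π_1(T^2); (iii) ∂X1 has at least two connected components that are non-contractible in T^2. -/
/-- The circle `ℝ/ℤ`. -/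
abbrev Circ : Type := AddCircle (1 : ℝ)

/-- The 2-torus `ℝ²/ℤ²`. -/
abbrev Torus2 : Type := Circ × Circ

open Topology

section Lifting

lemma AddCircle.exists_continuousMap_lift {A : Type*} [TopologicalSpace A] [SimplyConnectedSpace A]
    [LocallyPathConnectedSpace A] (f : C(A, Circ)) :
    ∃ g : C(A, ℝ), ∀ a, ((g a : ℝ) : Circ) = f a := by
  obtain ⟨a₀⟩ : Nonempty A := inferInstance
  obtain ⟨t, ht⟩ := QuotientAddGroup.mk_surjective (f a₀)
  obtain ⟨g, ⟨-, hg⟩, -⟩ :=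
    (AddCircle.isCoveringMap_coe (1 : ℝ)).existsUnique_continuousMap_lifts f a₀ t ht
  exact ⟨g, congrFun hg⟩

lemma Complex.exists_continuousMap_log {A : Type*} [TopologicalSpace A] [SimplyConnectedSpace A]
    [LocallyPathConnectedSpace A] (f : C(A, ℂ)) (hf : ∀ a, f a ≠ 0) :
    ∃ g : C(A, ℂ), ∀ a, Complex.exp (g a) = f a := by
  obtain ⟨a₀⟩ : Nonempty A := inferInstance
  let F : C(A, {z : ℂ // z ≠ 0}) := ⟨fun a => ⟨f a, hf a⟩, by fun_prop⟩
  obtain ⟨g, ⟨-, hg⟩, -⟩ := Complex.isCoveringMap_exp.existsUnique_continuousMap_lifts F a₀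
    (Complex.log (f a₀)) (Subtype.ext (Complex.exp_log (hf a₀)))
  exact ⟨g, fun a => congrArg Subtype.val (congrFun hg a)⟩

lemma Complex.eq_of_exp_eq_const {A : Type*} [TopologicalSpace A] [PreconnectedSpace A]
    {r : A → ℂ} (hr : Continuous r) {c : ℂ} (hc : ∀ a, Complex.exp (r a) = c) (a b : A) :
    r a = r b :=
  Complex.isCoveringMap_exp.const_of_comp hr
    (fun x y => Subtype.ext ((hc x).trans (hc y).symm)) a b

lemma AddCircle.coe_sub_eq_zero_of_coe_eq {x y : ℝ} (h : (x : Circ) = (y : Circ)) :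
    ∃ n : ℤ, x = y + n := by
  have h0 : ((x - y : ℝ) : Circ) = 0 := by rw [AddCircle.coe_sub, h, sub_self]
  obtain ⟨n, hn⟩ := (AddCircle.coe_eq_zero_iff (1 : ℝ)).1 h0
  refine ⟨n, ?_⟩
  simp only [zsmul_eq_mul, mul_one] at hn
  linarith

@[simp] lemma AddCircle.coe_intCast (n : ℤ) : (((n : ℤ) : ℝ) : Circ) = 0 :=
  (AddCircle.coe_eq_zero_iff (1 : ℝ)).2 ⟨n, by simp⟩

lemma AddCircle.coe_one_eq_zero : ((1 : ℝ) : Circ) = 0 := by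
  exact_mod_cast AddCircle.coe_intCast 1

lemma AddCircle.coe_int_mul (n : ℤ) (x : ℝ) : ((n * x : ℝ) : Circ) = n • (x : Circ) := by
  rw [← AddCircle.coe_zsmul, zsmul_eq_mul]

lemma AddCircle.continuous_coe : Continuous ((↑) : ℝ → Circ) :=
  AddCircle.continuous_mk' _

/-- Two lifts of the same circle-valued function on a preconnected space differ by an integer. -/
lemma AddCircle.exists_int_of_coe_eq {A : Type*} [TopologicalSpace A] [PreconnectedSpace A]
    {f g : A → ℝ} (hf : Continuous f) (hg : Continuous g)
    (h : ∀ a, (f a : Circ) = (g a : Circ)) : ∃ n : ℤ, ∀ a, f a = g a + n := by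
  rcases isEmpty_or_nonempty A with hA | ⟨⟨a₀⟩⟩
  · exact ⟨0, fun a => hA.elim a⟩
  obtain ⟨n, hn⟩ := AddCircle.coe_sub_eq_zero_of_coe_eq (h a₀)
  refine ⟨n, fun a => congrFun ((AddCircle.isCoveringMap_coe (1 : ℝ)).eq_of_comp_eq
    (g₂ := fun a => g a + n) hf (by fun_prop) ?_ a₀ hn) a⟩
  ext a
  simp [h a]

lemma Circ.exists_degree (f : C(Circ, Circ)) :
    ∃ (n : ℤ) (g : C(Circ, ℝ)), ∀ t, f t = n • t + ((g t : ℝ) : Circ) := by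
  obtain ⟨F, hF⟩ := AddCircle.exists_continuousMap_lift
    (f.comp ⟨((↑) : ℝ → Circ), AddCircle.continuous_coe⟩)
  replace hF : ∀ t : ℝ, (F t : Circ) = f t := hF
  obtain ⟨n, hn⟩ := AddCircle.exists_int_of_coe_eq (f := fun t => F (t + 1)) (g := F)
    (by fun_prop) (by fun_prop) (fun t => by rw [hF, hF]; simp)
  have hper : Function.Periodic (fun t : ℝ => F t - n * t) 1 := fun t => by
    simp only [hn]; ring
  refine ⟨n, ⟨hper.lift, ?_⟩, fun t => ?_⟩
  · exact continuous_coinduced_dom.2 (by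
      change Continuous (fun t : ℝ => F t - n * t); fun_prop)
  · induction t using QuotientAddGroup.induction_on with
    | H t =>
      change f (t : Circ) = n • (t : Circ) + ((F t - n * t : ℝ) : Circ)
      rw [AddCircle.coe_sub, AddCircle.coe_int_mul, hF]
      abel

/-- `f` is homotopic to the character `(s, t) ↦ a s + b t` of the torus. -/
def Torus2.HasClass (f : C(Torus2, Circ)) (a b : ℤ) : Prop :=
  ∃ g : C(Torus2, ℝ), ∀ p : Torus2, f p = a • p.1 + b • p.2 + ((g p : ℝ) : Circ)

/-- The circle-valued function `f` has a real-valued lift over `s` that extends to the torus. -/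
def Torus2.LiftsOn (f : C(Torus2, Circ)) (s : Set Torus2) : Prop :=
  ∃ g : C(Torus2, ℝ), ∀ p ∈ s, f p = ((g p : ℝ) : Circ)

/-- The projection of the plane onto the torus. -/
def Torus2.proj (z : ℂ) : Torus2 := ((z.re : Circ), (z.im : Circ))

lemma Torus2.continuous_proj : Continuous Torus2.proj :=
  (AddCircle.continuous_coe.comp Complex.continuous_re).prodMk
    (AddCircle.continuous_coe.comp Complex.continuous_im)

lemma Torus2.proj_add (z w : ℂ) : proj (z + w) = proj z + proj w := by
  simp [proj]

lemma Torus2.proj_one : proj 1 = 0 := by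
  simp [proj, AddCircle.coe_one_eq_zero]

lemma Torus2.proj_I : proj Complex.I = 0 := by
  simp [proj, AddCircle.coe_one_eq_zero]

lemma Torus2.exists_hasClass (f : C(Torus2, Circ)) : ∃ a b : ℤ, HasClass f a b := by
  obtain ⟨F, hF⟩ := AddCircle.exists_continuousMap_lift
    (f.comp ⟨fun z : ℝ × ℝ => ((z.1 : Circ), (z.2 : Circ)),
      (AddCircle.continuous_coe.comp continuous_fst).prodMk
        (AddCircle.continuous_coe.comp continuous_snd)⟩)
  replace hF : ∀ s t : ℝ, (F (s, t) : Circ) = f (s, t) := fun s t => hF (s, t)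
  obtain ⟨a, ha⟩ := AddCircle.exists_int_of_coe_eq (f := fun z : ℝ × ℝ => F (z.1 + 1, z.2))
    (g := F) (by fun_prop) (by fun_prop)
    (fun z => by rw [hF, show F z = F (z.1, z.2) from rfl, hF]; simp)
  obtain ⟨b, hb⟩ := AddCircle.exists_int_of_coe_eq (f := fun z : ℝ × ℝ => F (z.1, z.2 + 1))
    (g := F) (by fun_prop) (by fun_prop)
    (fun z => by rw [hF, show F z = F (z.1, z.2) from rfl, hF]; simp)
  let G : ℝ → ℝ → ℝ := fun s t => F (s, t) - a * s - b * t
  have hG1 : ∀ s t, G (s + 1) t = G s t := fun s t => by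
    have := ha (s, t); simp only [G] at this ⊢; rw [this]; ring
  have hG2 : ∀ s t, G s (t + 1) = G s t := fun s t => by
    have := hb (s, t); simp only [G] at this ⊢; rw [this]; ring
  let H : ℝ → Circ → ℝ := fun s => (show Function.Periodic (G s) 1 from hG2 s).lift
  have hH : Function.Periodic H 1 := fun s => by
    ext t
    induction t using QuotientAddGroup.induction_on with
    | H t => exact hG1 s t
  have hq : IsOpenQuotientMap (fun z : ℝ × ℝ => ((z.1 : Circ), (z.2 : Circ))) :=
    IsOpenQuotientMap.prodMap QuotientAddGroup.isOpenQuotientMap_mk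
      QuotientAddGroup.isOpenQuotientMap_mk
  refine ⟨a, b, ⟨fun p => hH.lift p.1 p.2, hq.isQuotientMap.continuous_iff.2 ?_⟩, ?_⟩
  · change Continuous (fun z : ℝ × ℝ => F (z.1, z.2) - a * z.1 - b * z.2)
    fun_prop
  · rintro ⟨s, t⟩
    induction s using QuotientAddGroup.induction_on with
    | H s =>
    induction t using QuotientAddGroup.induction_on with
    | H t =>
      change f (s, t) = a • (s : Circ) + b • (t : Circ) +
        ((F (s, t) - a * s - b * t : ℝ) : Circ)
      rw [AddCircle.coe_sub, AddCircle.coe_sub, AddCircle.coe_int_mul, AddCircle.coe_int_mul, hF]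
      abel

end Lifting
section Degree

open Complex in
/-- A continuous self-map of the plane at bounded distance from the identity has a zero. -/
lemma Complex.exists_eq_zero_of_norm_sub_le {F : ℂ → ℂ} (hF : Continuous F) {R : ℝ}
    (hR : ∀ z, ‖F z - z‖ ≤ R) : ∃ z, F z = 0 := by
  by_contra! h0
  obtain ⟨w, hw⟩ := Complex.exists_continuousMap_log ⟨F, hF⟩ h0
  have hR0 : 0 ≤ R := (norm_nonneg _).trans (hR 0)
  set c : ℝ → ℂ := fun t => ((R + 1 : ℝ) : ℂ) * exp (t * I) with hc
  have hcn : ∀ t, ‖c t‖ = R + 1 := fun t => by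
    rw [hc]; simp only [norm_mul, Complex.norm_exp_ofReal_mul_I, mul_one, Complex.norm_real]
    exact abs_of_nonneg (by linarith)
  have hc0 : ∀ t, c t ≠ 0 := fun t => norm_pos_iff.1 (by rw [hcn]; linarith)
  have hcc : Continuous c := by fun_prop
  have hslit : ∀ t, F (c t) / c t ∈ slitPlane := fun t => by
    have h : ‖F (c t) / c t - 1‖ < 1 := by
      rw [div_sub_one (hc0 t), norm_div, hcn, div_lt_one (by linarith)]
      linarith [hR (c t)]
    simpa using Complex.mem_slitPlane_of_norm_lt_one h
  have hlog : Continuous fun t => log (F (c t) / c t) :=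
    Continuous.clog ((hF.comp hcc).div hcc hc0) hslit
  have hconst := Complex.eq_of_exp_eq_const
    (r := fun t : ℝ => w (c t) - log (F (c t) / c t) - t * I) (c := ((R + 1 : ℝ) : ℂ))
    (by fun_prop) (fun t => by
      have h1 : exp (w (c t)) = F (c t) := hw (c t)
      have h2 := h0 (c t)
      have h3 := hc0 t
      rw [exp_sub, exp_sub, h1, exp_log (div_ne_zero h2 h3), div_div_cancel₀ h2]
      simp only [hc]
      field_simp) 0 (2 * Real.pi)
  have hper : c (2 * Real.pi) = c 0 := by simp [hc, exp_two_pi_mul_I]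
  simp only [hper] at hconst
  have : (2 * Real.pi : ℂ) * I = 0 := by
    have := sub_right_injective hconst
    push_cast at this
    simpa using this.symm
  exact two_pi_I_ne_zero this

/-- The cup product of two classes vanishes when they vanish on the members of a cover. -/
lemma Torus2.HasClass.mul_eq_mul {f f' : C(Torus2, Circ)} {a b c d : ℤ}
    (hf : HasClass f a b) (hf' : HasClass f' c d) {A B : Set Torus2} (hAB : A ∪ B = Set.univ)
    (hA : LiftsOn f A) (hB : LiftsOn f' B) : a * d = b * c := by
  obtain ⟨g, hg⟩ := hf
  obtain ⟨g', hg'⟩ := hf'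
  obtain ⟨u, hu⟩ := hA
  obtain ⟨v, hv⟩ := hB
  by_contra hdet
  have hD : (a * d - b * c : ℝ) ≠ 0 := fun h => hdet (by
    have : (a * d : ℝ) = b * c := by linarith
    exact_mod_cast this)
  set D : ℝ := a * d - b * c with hDdef
  let h₁ : C(Torus2, ℝ) := g - u - .const _ (1 / 2)
  let h₂ : C(Torus2, ℝ) := g' - v - .const _ (1 / 2)
  let k₁ : C(Torus2, ℝ) := .const _ D⁻¹ * (.const _ (d : ℝ) * h₁ - .const _ (b : ℝ) * h₂)
  let k₂ : C(Torus2, ℝ) := .const _ D⁻¹ * (.const _ (a : ℝ) * h₂ - .const _ (c : ℝ) * h₁)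
  have hk₁ : ∀ p, a * k₁ p + b * k₂ p = h₁ p := fun p => by
    simp only [k₁, k₂, ContinuousMap.mul_apply, ContinuousMap.const_apply, ContinuousMap.sub_apply]
    field_simp; rw [hDdef]; ring
  have hk₂ : ∀ p, c * k₁ p + d * k₂ p = h₂ p := fun p => by
    simp only [k₁, k₂, ContinuousMap.mul_apply, ContinuousMap.const_apply, ContinuousMap.sub_apply]
    field_simp; rw [hDdef]; ring
  have hhalf : ((1 / 2 : ℝ) : Circ) ≠ 0 := fun h => by
    have := AddCircle.norm_half_period_eq (1 : ℝ)
    rw [h] at this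
    norm_num at this
  obtain ⟨z, hz⟩ := Complex.exists_eq_zero_of_norm_sub_le
    (F := fun z => z + ((k₁ (proj z) : ℂ) + k₂ (proj z) * Complex.I)) (R := ‖k₁‖ + ‖k₂‖)
    (by have := continuous_proj; fun_prop) (fun z => by
      rw [add_sub_cancel_left]
      refine (norm_add_le _ _).trans ?_
      rw [norm_mul, Complex.norm_I, mul_one, Complex.norm_real, Complex.norm_real]
      exact add_le_add (k₁.norm_coe_le_norm _) (k₂.norm_coe_le_norm _))
  have h₁z : z.re + k₁ (proj z) = 0 := by simpa using congrArg Complex.re hz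
  have h₂z : z.im + k₂ (proj z) = 0 := by simpa using congrArg Complex.im hz
  have e₁ : a * z.re + b * z.im + (g (proj z) - u (proj z)) = 1 / 2 := by
    have h := hk₁ (proj z)
    simp only [h₁, ContinuousMap.sub_apply, ContinuousMap.const_apply] at h
    linear_combination a * h₁z + b * h₂z - h
  have e₂ : c * z.re + d * z.im + (g' (proj z) - v (proj z)) = 1 / 2 := by
    have h := hk₂ (proj z)
    simp only [h₂, ContinuousMap.sub_apply, ContinuousMap.const_apply] at h
    linear_combination c * h₁z + d * h₂z - h
  rcases (hAB ▸ Set.mem_univ (proj z) : proj z ∈ A ∪ B) with h | h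
  · apply hhalf
    rw [← e₁, AddCircle.coe_add, AddCircle.coe_add, AddCircle.coe_sub, AddCircle.coe_int_mul,
      AddCircle.coe_int_mul, ← hu _ h, hg]
    simp [proj]
  · apply hhalf
    rw [← e₂, AddCircle.coe_add, AddCircle.coe_add, AddCircle.coe_sub, AddCircle.coe_int_mul,
      AddCircle.coe_int_mul, ← hv _ h, hg']
    simp [proj]

open Complex in
/-- A doubly periodic continuous function whose only zero in a period square is at the origin
has index zero there. -/
lemma Complex.index_eq_zero_of_periodic {X U₀ : ℂ → ℂ} (hX : Continuous X)
    (hX1 : ∀ z, X (z + 1) = X z) (hXI : ∀ z, X (z + I) = X z)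
    (hne : ∀ z : ℂ, |z.re| ≤ 1 / 2 → |z.im| ≤ 1 / 2 → z ≠ 0 → X z ≠ 0) (p : ℕ)
    (hU₀ : ContinuousAt U₀ 0) (hU₀0 : U₀ 0 ≠ 0) (hloc : ∀ᶠ z in 𝓝 0, X z = z ^ p * U₀ z) :
    p = 0 := by
  classical
  let U : ℂ → ℂ := fun z => if z = 0 then U₀ 0 else X z / z ^ p
  have hUX : ∀ z, z ≠ 0 → X z = z ^ p * U z := fun z hz => by
    simp only [U, if_neg hz]
    field_simp
  have hU : Continuous U := by
    rw [continuous_iff_continuousAt]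
    intro z
    rcases eq_or_ne z 0 with rfl | hz
    · refine hU₀.congr ?_
      filter_upwards [hloc] with z hz
      simp only [U]
      split_ifs with h
      · rw [h]
      · rw [hz, mul_div_cancel_left₀ _ (pow_ne_zero _ h)]
    · refine ContinuousAt.congr (f := fun z => X z / z ^ p)
        (hX.continuousAt.div (by fun_prop) (pow_ne_zero _ hz)) ?_
      filter_upwards [isOpen_ne.mem_nhds hz] with y hy
      simp only [U, if_neg hy]
  let cl : ℝ → ℝ := fun t => max (-(1 / 2)) (min (1 / 2) t)
  have hcl : ∀ t, |cl t| ≤ 1 / 2 := fun t =>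
    abs_le.2 ⟨le_max_left _ _, max_le (by norm_num) (min_le_left _ _)⟩
  have hcl' : ∀ t, |t| ≤ 1 / 2 → cl t = t := fun t ht => by
    obtain ⟨h1, h2⟩ := abs_le.1 ht
    simp only [cl, min_eq_right h2, max_eq_right h1]
  have hclc : Continuous cl := by fun_prop
  let κ : ℂ → ℂ := fun z => (cl z.re : ℂ) + cl z.im * I
  have hκ : ∀ z : ℂ, |z.re| ≤ 1 / 2 → |z.im| ≤ 1 / 2 → κ z = z := fun z h1 h2 => by
    simp only [κ, hcl' _ h1, hcl' _ h2, re_add_im]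
  obtain ⟨w, hw⟩ := Complex.exists_continuousMap_log ⟨fun z => U (κ z), by fun_prop⟩ (fun z => by
    change U (κ z) ≠ 0
    have h1 : |(κ z).re| ≤ 1 / 2 := by simpa [κ] using hcl z.re
    have h2 : |(κ z).im| ≤ 1 / 2 := by simpa [κ] using hcl z.im
    by_cases h : κ z = 0
    · simpa only [U, if_pos h] using hU₀0
    · intro h'
      exact hne _ h1 h2 h (by rw [hUX _ h, h', mul_zero]))
  have hXw : ∀ z : ℂ, |z.re| ≤ 1 / 2 → |z.im| ≤ 1 / 2 → z ≠ 0 → X z = z ^ p * exp (w z) :=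
    fun z h1 h2 h => by
      rw [hw, hUX _ h]
      change _ = _ * U (κ z)
      rw [hκ z h1 h2]
  have hre : ∀ t : ℝ, (1 / 2 + t * I : ℂ) ∈ slitPlane := fun t => Or.inl (by simp)
  have hre' : ∀ t : ℝ, (1 / 2 - t * I : ℂ) ∈ slitPlane := fun t => Or.inl (by simp)
  have hne₁ : ∀ t : ℝ, (1 / 2 + t * I : ℂ) ≠ 0 := fun t => slitPlane_ne_zero (hre t)
  have hne₂ : ∀ t : ℝ, (1 / 2 - t * I : ℂ) ≠ 0 := fun t => slitPlane_ne_zero (hre' t)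
  have hL₁ : Continuous fun t : ℝ => log (1 / 2 + t * I) :=
    Continuous.clog (by fun_prop) hre
  have hL₂ : Continuous fun t : ℝ => log (1 / 2 - t * I) :=
    Continuous.clog (by fun_prop) hre'
  have hexp₁ : ∀ t : ℝ, exp (p * log (1 / 2 + t * I)) = (1 / 2 + t * I) ^ p := fun t => by
    rw [exp_nat_mul, exp_log (hne₁ t)]
  have hexp₂ : ∀ t : ℝ, exp (p * log (1 / 2 - t * I)) = (1 / 2 - t * I) ^ p := fun t => by
    rw [exp_nat_mul, exp_log (hne₂ t)]
  have hside := Complex.eq_of_exp_eq_const (c := (-1) ^ p)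
    (r := fun t : ℝ => p * log (1 / 2 + (cl t : ℝ) * I) - p * log (1 / 2 - (cl t : ℝ) * I) +
      w (1 / 2 + (cl t : ℝ) * I) - w (-(1 / 2 - (cl t : ℝ) * I)))
    (by have := hL₁.comp hclc; have := hL₂.comp hclc; fun_prop) (fun t => by
      have h1 := hXw (1 / 2 + (cl t : ℝ) * I) (by norm_num) (by simpa using hcl t) (hne₁ _)
      have h2 := hXw (-(1 / 2 - (cl t : ℝ) * I)) (by norm_num) (by simpa using hcl t)
        (neg_ne_zero.2 (hne₂ _))
      have h3 := hX1 (-(1 / 2 - (cl t : ℝ) * I))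
      rw [show -(1 / 2 - (cl t : ℝ) * I) + 1 = 1 / 2 + (cl t : ℝ) * I by ring, h1, h2, neg_pow] at h3
      rw [exp_sub, exp_add, exp_sub, hexp₁, hexp₂]
      have := pow_ne_zero p (hne₂ (cl t))
      have := exp_ne_zero (w (-(1 / 2 - (cl t : ℝ) * I)))
      rw [div_mul_eq_mul_div, div_div, div_eq_iff (by positivity), h3]
      ring) (1 / 2) (-(1 / 2))
  have htop := Complex.eq_of_exp_eq_const (c := (-1) ^ p)
    (r := fun t : ℝ => p * log (1 / 2 - (cl t : ℝ) * I) - p * log (1 / 2 + (cl t : ℝ) * I) +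
      w (I * (1 / 2 - (cl t : ℝ) * I)) - w (-I * (1 / 2 + (cl t : ℝ) * I)))
    (by have := hL₁.comp hclc; have := hL₂.comp hclc; fun_prop) (fun t => by
      have h1 := hXw (I * (1 / 2 - (cl t : ℝ) * I)) (by simpa using hcl t) (by norm_num)
        (mul_ne_zero I_ne_zero (hne₂ _))
      have h2 := hXw (-I * (1 / 2 + (cl t : ℝ) * I)) (by simpa using hcl t) (by norm_num)
        (mul_ne_zero (neg_ne_zero.2 I_ne_zero) (hne₁ _))
      have h3 := hXI (-I * (1 / 2 + (cl t : ℝ) * I))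
      rw [show -I * (1 / 2 + (cl t : ℝ) * I) + I = I * (1 / 2 - (cl t : ℝ) * I) by ring, h1, h2,
        mul_pow, mul_pow, neg_pow I] at h3
      have h4 := pow_ne_zero p (hne₁ (cl t))
      have h5 := exp_ne_zero (w (-I * (1 / 2 + (cl t : ℝ) * I)))
      have h6 := pow_ne_zero p I_ne_zero
      rw [exp_sub, exp_add, exp_sub, hexp₁, hexp₂]
      rw [div_mul_eq_mul_div, div_div, div_eq_iff (mul_ne_zero h4 h5)]
      apply mul_left_cancel₀ h6
      linear_combination h3) (1 / 2) (-(1 / 2))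
  simp only [hcl' (1 / 2) (by norm_num), hcl' (-(1 / 2)) (by norm_num)] at hside htop
  push_cast at hside htop
  set P : ℂ := 1 / 2 + 1 / 2 * I with hP
  set Q : ℂ := 1 / 2 - 1 / 2 * I with hQ
  rw [show (1 / 2 + -(1 / 2) * I : ℂ) = Q by rw [hQ]; ring,
    show (1 / 2 - -(1 / 2) * I : ℂ) = P by rw [hP]; ring] at hside htop
  rw [show I * Q = P by rw [hP, hQ]; linear_combination (-1 / 2) * I_sq,
    show -I * P = Q by rw [hP, hQ]; linear_combination (-1 / 2) * I_sq,
    show I * P = -Q by rw [hP, hQ]; linear_combination (1 / 2) * I_sq,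
    show -I * Q = -P by rw [hP, hQ]; linear_combination (1 / 2) * I_sq] at htop
  have hPQ : log P - log Q ≠ 0 := fun h => by
    have hP0 : P ≠ 0 := fun h => by have := congrArg re h; norm_num [hP] at this
    have hQ0 : Q ≠ 0 := fun h => by have := congrArg re h; norm_num [hQ] at this
    have := congrArg exp (sub_eq_zero.1 h)
    rw [exp_log hP0, exp_log hQ0] at this
    have := congrArg im this
    norm_num [hP, hQ] at this
  have h4 : (4 * p : ℂ) * (log P - log Q) = 0 := by linear_combination hside - htop
  rcases mul_eq_zero.1 h4 with h | h
  · simpa using h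
  · exact absurd h hPQ

end Degree
section Loops

open unitInterval

/-- A nullhomotopic circle-valued map has a real-valued lift. -/
lemma Circ.exists_lift_of_nullhomotopic {A : Type*} [TopologicalSpace A] {f : C(A, Circ)}
    (hf : f.Nullhomotopic) : ∃ g : C(A, ℝ), ∀ a, f a = ((g a : ℝ) : Circ) := by
  obtain ⟨y, ⟨F⟩⟩ := hf
  obtain ⟨t, rfl⟩ := QuotientAddGroup.mk_surjective y
  have cov := AddCircle.isCoveringMap_coe (1 : ℝ)
  have h0 : ∀ a, F.symm (0, a) = ((ContinuousMap.const A t a : ℝ) : Circ) := fun a =>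
    F.symm.apply_zero a
  let H := cov.liftHomotopy F.symm.toContinuousMap (.const A t) h0
  refine ⟨H.comp ⟨fun a => (1, a), by fun_prop⟩, fun a => ?_⟩
  have := congrFun (cov.liftHomotopy_lifts F.symm.toContinuousMap (.const A t) h0) (1, a)
  exact ((F.symm.apply_one a).symm.trans this.symm)

lemma Torus2.nullhomotopic_of_lifts {A : Type*} [TopologicalSpace A] {f : C(A, Torus2)}
    {g₁ g₂ : A → ℝ} (hg₁ : Continuous g₁) (hg₂ : Continuous g₂)
    (h₁ : ∀ a, (f a).1 = (g₁ a : Circ)) (h₂ : ∀ a, (f a).2 = (g₂ a : Circ)) :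
    f.Nullhomotopic := by
  let P : C(ℝ × ℝ, Torus2) := ⟨fun z => ((z.1 : Circ), (z.2 : Circ)),
    (AddCircle.continuous_coe.comp continuous_fst).prodMk
      (AddCircle.continuous_coe.comp continuous_snd)⟩
  have h : f = P.comp ⟨fun a => (g₁ a, g₂ a), by fun_prop⟩ := by
    ext a
    · exact h₁ a
    · exact h₂ a
  rw [h]
  have := ((id_nullhomotopic (ℝ × ℝ)).comp_right P).comp_left
    (⟨fun a => (g₁ a, g₂ a), by fun_prop⟩ : C(A, ℝ × ℝ))
  exact this

/-- A closed path, as a map from the circle. -/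
lemma Path.exists_circle_map {X : Type*} [TopologicalSpace X] {x : X} (γ : Path x x) :
    ∃ ℓ : C(Circ, X), Set.range ℓ ⊆ Set.range γ ∧ ∀ t : I, ℓ ((t : ℝ) : Circ) = γ t := by
  have : Fact ((0 : ℝ) < 1) := ⟨one_pos⟩
  have h01 : γ.extend 0 = γ.extend (0 + 1) := by simp
  refine ⟨⟨AddCircle.liftIco 1 0 γ.extend, AddCircle.liftIco_continuous h01
    γ.continuous_extend.continuousOn⟩, ?_, fun t => ?_⟩
  · rintro _ ⟨s, rfl⟩
    obtain ⟨t, ht, rfl⟩ := AddCircle.eq_coe_Ico s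
    simp only [ContinuousMap.coe_mk]
    rw [AddCircle.liftIco_coe_apply (by simpa using ht)]
    exact ⟨⟨t, ht.1, ht.2.le⟩, (γ.extend_apply _).symm⟩
  · simp only [ContinuousMap.coe_mk]
    rcases eq_or_lt_of_le t.2.2 with h | h
    · have h1 : t = 1 := Subtype.ext h
      rw [h, h1, AddCircle.coe_one_eq_zero, ← AddCircle.coe_zero,
        AddCircle.liftIco_coe_apply (by simp)]
      simp
    · rw [AddCircle.liftIco_coe_apply (by simpa using ⟨t.2.1, h⟩)]
      exact γ.extend_apply t.2

/-- If `f` lifts along every loop in the open connected set `U`, then it lifts over `U`. -/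
lemma Circ.exists_lift_of_isConnected {X : Type*} [TopologicalSpace X]
    [LocallyPathConnectedSpace X] {U : Set X} (hU : IsOpen U) (hUc : IsConnected U)
    (f : C(X, Circ)) (hf : ∀ ℓ : C(Circ, X), Set.range ℓ ⊆ U →
      ∃ g : C(Circ, ℝ), ∀ t, f (ℓ t) = ((g t : ℝ) : Circ)) :
    ∃ g : C(U, ℝ), ∀ p : U, f p = ((g p : ℝ) : Circ) := by
  have : LocallyPathConnectedSpace U := hU.locallyPathConnectedSpace
  have : ConnectedSpace U := isConnected_iff_connectedSpace.1 hUc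
  have : PathConnectedSpace U := pathConnectedSpace_iff_connectedSpace.2 inferInstance
  have cov := AddCircle.isCoveringMap_coe (1 : ℝ)
  obtain ⟨a₀⟩ : Nonempty U := inferInstance
  let fU : C(U, Circ) := f.comp ⟨Subtype.val, continuous_subtype_val⟩
  obtain ⟨t₀, ht₀⟩ := QuotientAddGroup.mk_surjective (fU a₀)
  obtain ⟨g, ⟨-, hg⟩, -⟩ := cov.isLocalHomeomorph.existsUnique_continuousMap_lifts fU a₀ t₀ ht₀
    (fun γ hγ => by
      simpa [and_comm] using cov.exists_path_lifts (fU.comp γ) t₀ (by simp [hγ, ht₀.symm])) (by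
      intro γ γ' Γ Γ' hγ hγ' hΓ hΓ' hl hl' h1
      let q : Path a₀ (γ 1) := ⟨γ, hγ, rfl⟩
      let q' : Path a₀ (γ 1) := ⟨γ', hγ', h1.symm⟩
      obtain ⟨ℓ, hℓ, hℓt⟩ := (q.trans q'.symm).exists_circle_map
      obtain ⟨k, hk⟩ := hf (ContinuousMap.comp ⟨Subtype.val, continuous_subtype_val⟩ ℓ) (by
        rintro _ ⟨t, rfl⟩; exact (ℓ t).2)
      have hhalf : ∀ t : I, (t : ℝ) / 2 ∈ I := fun t =>
        ⟨by linarith [t.2.1], by linarith [t.2.2]⟩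
      have hhalf' : ∀ t : I, 1 - (t : ℝ) / 2 ∈ I := fun t =>
        ⟨by linarith [t.2.2], by linarith [t.2.1]⟩
      have key : ∀ t : I, ℓ (((t : ℝ) / 2 : ℝ) : Circ) = γ t := fun t => by
        have := hℓt ⟨t / 2, hhalf t⟩
        rw [this, Path.trans_apply, dif_pos (by change (t : ℝ) / 2 ≤ 1 / 2; linarith [t.2.2])]
        change γ _ = γ t
        congr 1; ext; simp only; ring
      have key' : ∀ t : I, ℓ ((1 - (t : ℝ) / 2 : ℝ) : Circ) = γ' t := fun t => by
        have h := hℓt ⟨1 - t / 2, hhalf' t⟩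
        have h2 := congrFun (congrArg DFunLike.coe (Path.trans_symm q q'.symm))
          ⟨t / 2, hhalf t⟩
        rw [h]
        have h3 : (⟨1 - (t : ℝ) / 2, hhalf' t⟩ : I) = σ ⟨t / 2, hhalf t⟩ := by ext; simp
        rw [h3]
        change (q.trans q'.symm).symm ⟨t / 2, hhalf t⟩ = γ' t
        rw [h2, Path.trans_apply, dif_pos (by change (t : ℝ) / 2 ≤ 1 / 2; linarith [t.2.2]),
          Path.symm_symm]
        change γ' _ = γ' t
        congr 1; ext; simp only; ring
      have hc := AddCircle.continuous_coe
      obtain ⟨n, hn⟩ := AddCircle.exists_int_of_coe_eq (f := Γ)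
        (g := fun t : I => k (((t : ℝ) / 2 : ℝ) : Circ)) (by fun_prop) (by fun_prop) (fun t => by
          rw [← hk]
          simp only [ContinuousMap.comp_apply, ContinuousMap.coe_mk, key]
          exact congrFun hl t)
      obtain ⟨n', hn'⟩ := AddCircle.exists_int_of_coe_eq (f := Γ')
        (g := fun t : I => k ((1 - (t : ℝ) / 2 : ℝ) : Circ)) (by fun_prop) (by fun_prop)
        (fun t => by
          rw [← hk]
          simp only [ContinuousMap.comp_apply, ContinuousMap.coe_mk, key']
          exact congrFun hl' t)
      have e0 := hn 0
      have e0' := hn' 0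
      have e1 := hn 1
      have e1' := hn' 1
      simp only [Set.Icc.coe_zero, Set.Icc.coe_one, zero_div, sub_zero,
        AddCircle.coe_one_eq_zero, AddCircle.coe_zero] at e0 e0' e1 e1'
      rw [show (1 - 1 / 2 : ℝ) = 1 / 2 by norm_num] at e1'
      linarith)
  exact ⟨g, fun p => (congrFun hg p).symm⟩

/-- If `f` lifts along every loop in the open set `U`, then it lifts over closed subsets of `U`. -/
lemma Circ.exists_lift_of_isClosed_subset {X : Type*} [TopologicalSpace X] [NormalSpace X]
    [LocallyPathConnectedSpace X] {U L : Set X} (hU : IsOpen U) (hL : IsClosed L) (hLU : L ⊆ U)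
    (f : C(X, Circ)) (hf : ∀ ℓ : C(Circ, X), Set.range ℓ ⊆ U →
      ∃ g : C(Circ, ℝ), ∀ t, f (ℓ t) = ((g t : ℝ) : Circ)) :
    ∃ g : C(X, ℝ), ∀ p ∈ L, f p = ((g p : ℝ) : Circ) := by
  classical
  have hex : ∀ V : Set X, ∃ g : X → ℝ, IsOpen V → IsConnected V → V ⊆ U →
      ContinuousOn g V ∧ ∀ p ∈ V, f p = ((g p : ℝ) : Circ) := fun V => by
    by_cases hV : IsOpen V ∧ IsConnected V ∧ V ⊆ U
    · obtain ⟨hVo, hVc, hVU⟩ := hV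
      obtain ⟨g, hg⟩ := Circ.exists_lift_of_isConnected hVo hVc f
        fun ℓ hℓ => hf ℓ (hℓ.trans hVU)
      refine ⟨fun p => if h : p ∈ V then g ⟨p, h⟩ else 0, fun _ _ _ => ⟨?_, fun p hp => ?_⟩⟩
      · rw [continuousOn_iff_continuous_domRestrict]
        convert g.continuous using 1
        ext p
        simp
      · simpa only [dif_pos hp] using hg ⟨p, hp⟩
    · exact ⟨0, fun h1 h2 h3 => absurd ⟨h1, h2, h3⟩ hV⟩
  choose G hG using hex
  have hcomp : ∀ p ∈ U, ContinuousOn (G (connectedComponentIn U p)) (connectedComponentIn U p) ∧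
      ∀ q ∈ connectedComponentIn U p, f q = ((G (connectedComponentIn U p) q : ℝ) : Circ) :=
    fun p hp => hG _ hU.connectedComponentIn (isConnected_connectedComponentIn_iff.2 hp)
      (connectedComponentIn_subset _ _)
  have hcont : ContinuousOn (fun p => G (connectedComponentIn U p) p) L := fun p hp => by
    have hmem : connectedComponentIn U p ∈ 𝓝 p :=
      hU.connectedComponentIn.mem_nhds (mem_connectedComponentIn (hLU hp))
    refine (((hcomp p (hLU hp)).1.continuousAt hmem).congr ?_).continuousWithinAt
    filter_upwards [hmem] with q hq
    rw [connectedComponentIn_eq hq]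
  obtain ⟨g, hg⟩ := ContinuousMap.exists_restrict_eq hL
    ⟨L.domRestrict (fun p => G (connectedComponentIn U p) p),
      continuousOn_iff_continuous_domRestrict.1 hcont⟩
  refine ⟨g, fun p hp => ?_⟩
  rw [show g p = G (connectedComponentIn U p) p from DFunLike.congr_fun hg ⟨p, hp⟩]
  exact (hcomp p (hLU hp)).2 p (mem_connectedComponentIn (hLU hp))

end Loops

section Separation

/-- Each point of the circle has a representative whose absolute value is its norm. -/
lemma Circ.exists_coe_eq (t : Circ) : ∃ s : ℝ, (s : Circ) = t ∧ |s| = ‖t‖ := by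
  obtain ⟨x, rfl⟩ := QuotientAddGroup.mk_surjective t
  refine ⟨x - round x, ?_, ?_⟩
  · rw [AddCircle.coe_sub, AddCircle.coe_intCast, sub_zero]
  · exact UnitAddCircle.norm_eq.symm

lemma Circ.norm_coe {s : ℝ} (hs : |s| ≤ 1 / 2) : ‖(s : Circ)‖ = |s| :=
  (AddCircle.norm_coe_eq_abs_iff 1 one_ne_zero).2 (by simpa using hs)

/-- A continuous function on the circle that is the identity near the origin. -/
noncomputable def Circ.tri (t : Circ) : ℝ := ‖t + ((1 / 4 : ℝ) : Circ)‖ - 1 / 4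

lemma Circ.continuous_tri : Continuous Circ.tri := by
  unfold Circ.tri; fun_prop

lemma Circ.tri_coe {s : ℝ} (hs : |s| ≤ 1 / 4) : Circ.tri (s : Circ) = s := by
  rw [abs_le] at hs
  have h : |s + 1 / 4| = s + 1 / 4 := abs_of_nonneg (by linarith)
  rw [Circ.tri, ← AddCircle.coe_add, Circ.norm_coe (by rw [h]; linarith), h]
  ring

lemma Circ.coe_tri {t : Circ} (ht : ‖t‖ ≤ 1 / 4) : ((Circ.tri t : ℝ) : Circ) = t := by
  obtain ⟨s, rfl, hs⟩ := Circ.exists_coe_eq t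
  rw [Circ.tri_coe (hs.trans_le ht)]

/-- A continuous function on the torus that inverts the projection near the origin. -/
noncomputable def Torus2.chart (d : Torus2) : ℂ := ⟨Circ.tri d.1, Circ.tri d.2⟩

lemma Torus2.continuous_chart : Continuous Torus2.chart := by
  have h : Torus2.chart = fun d => ((Circ.tri d.1 : ℝ) : ℂ) + (Circ.tri d.2 : ℝ) * Complex.I := by
    ext d
    apply Complex.ext <;> simp [Torus2.chart]
  rw [h]
  have := Circ.continuous_tri
  fun_prop

lemma Torus2.chart_proj {z : ℂ} (h₁ : |z.re| ≤ 1 / 4) (h₂ : |z.im| ≤ 1 / 4) :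
    Torus2.chart (Torus2.proj z) = z :=
  Complex.ext (Circ.tri_coe h₁) (Circ.tri_coe h₂)

lemma Torus2.exists_proj_eq (d : Torus2) :
    ∃ z : ℂ, Torus2.proj z = d ∧ |z.re| ≤ ‖d‖ ∧ |z.im| ≤ ‖d‖ := by
  obtain ⟨s, hs, hs'⟩ := Circ.exists_coe_eq d.1
  obtain ⟨t, ht, ht'⟩ := Circ.exists_coe_eq d.2
  exact ⟨⟨s, t⟩, Prod.ext hs ht, hs'.trans_le (norm_fst_le d), ht'.trans_le (norm_snd_le d)⟩

lemma Torus2.norm_proj_le {z : ℂ} {r : ℝ} (hr : r ≤ 1 / 2) (h₁ : |z.re| ≤ r)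
    (h₂ : |z.im| ≤ r) : ‖Torus2.proj z‖ ≤ r :=
  max_le ((Circ.norm_coe (h₁.trans hr)).trans_le h₁) ((Circ.norm_coe (h₂.trans hr)).trans_le h₂)

/-- A function on the torus with a simple zero at `a` and a simple pole at `b`. -/
lemma Torus2.exists_zero_pole {a b : Torus2} (hab : a ≠ b) (h : ‖a - b‖ ≤ 1 / 32) :
    ∃ (ψ : Torus2 → ℂ) (s : ℂ), s ≠ 0 ∧ ContinuousOn ψ {b}ᶜ ∧ (∀ p, ψ p = 0 → p = a) ∧
      ∀ᶠ z in 𝓝 0, ψ (a + Torus2.proj z) = z / (s + z) := by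
  let cut : ℝ → ℝ := fun r => max 0 (min 1 (3 - 16 * r))
  have cut_one : ∀ r ≤ 1 / 8, cut r = 1 := fun r hr => by
    simp only [cut]
    rw [min_eq_left (by linarith), max_eq_right zero_le_one]
  have cut_zero : ∀ r, 3 / 16 ≤ r → cut r = 0 := fun r hr => by
    simp only [cut]
    rw [max_eq_left]
    exact (min_le_right _ _).trans (by linarith)
  have cut_nonneg : ∀ r, 0 ≤ cut r := fun r => le_max_left _ _
  have cut_le : ∀ r, cut r ≤ 1 := fun r => max_le zero_le_one (min_le_left _ _)
  have cut_cont : Continuous cut := by fun_prop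
  obtain ⟨s, hs, hs₁, hs₂⟩ := Torus2.exists_proj_eq (a - b)
  have hs0 : s ≠ 0 := by
    rintro rfl
    exact hab (sub_eq_zero.1 (hs.symm.trans (by simp [Torus2.proj])))
  let ψ : Torus2 → ℂ := fun p => 1 - (cut ‖p - b‖ : ℝ) * (s / Torus2.chart (p - b))
  refine ⟨ψ, s, hs0, fun p hp => ContinuousAt.continuousWithinAt ?_, fun p hp => ?_, ?_⟩
  · have hch := Torus2.continuous_chart
    by_cases h0 : Torus2.chart (p - b) = 0
    · have hnorm : 1 / 4 < ‖p - b‖ := by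
        by_contra! hle
        obtain ⟨z, hz, hz₁, hz₂⟩ := Torus2.exists_proj_eq (p - b)
        rw [← hz, Torus2.chart_proj (hz₁.trans hle) (hz₂.trans hle)] at h0
        rw [h0] at hz
        exact hp (sub_eq_zero.1 (hz.symm.trans (by simp [Torus2.proj])))
      have hev : ∀ᶠ q in 𝓝 p, 3 / 16 < ‖q - b‖ :=
        (isOpen_lt continuous_const (by fun_prop : Continuous fun q : Torus2 => ‖q - b‖)).mem_nhds
          (show 3 / 16 < ‖p - b‖ by linarith)
      refine (continuousAt_const (y := (1 : ℂ))).congr ?_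
      filter_upwards [hev] with q hq
      simp [ψ, cut_zero _ hq.le]
    · have h1 : ContinuousAt (fun q : Torus2 => Torus2.chart (q - b)) p := by fun_prop
      have h2 : ContinuousAt (fun q : Torus2 => ((cut ‖q - b‖ : ℝ) : ℂ)) p := by fun_prop
      exact continuousAt_const.sub (h2.mul (continuousAt_const.div h1 h0))
  · obtain ⟨z, hz, hz₁, hz₂⟩ := Torus2.exists_proj_eq (p - b)
    have hnorm : ‖p - b‖ ≤ 1 / 4 := by
      by_contra! hlt
      simp [ψ, cut_zero ‖p - b‖ (by linarith)] at hp
    have hch : Torus2.chart (p - b) = z := by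
      rw [← hz, Torus2.chart_proj (hz₁.trans hnorm) (hz₂.trans hnorm)]
    simp only [ψ, hch] at hp
    have hz0 : z ≠ 0 := by
      rintro rfl
      simp at hp
    have hzs : z = (cut ‖p - b‖ : ℝ) * s := by
      field_simp at hp
      linear_combination hp
    have hsmall : ‖p - b‖ ≤ 1 / 32 := by
      rw [← hz]
      refine Torus2.norm_proj_le (by norm_num) ?_ ?_
      · rw [hzs, Complex.re_ofReal_mul, abs_mul, abs_of_nonneg (cut_nonneg _)]
        exact (mul_le_of_le_one_left (abs_nonneg _) (cut_le _)).trans (hs₁.trans h)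
      · rw [hzs, Complex.im_ofReal_mul, abs_mul, abs_of_nonneg (cut_nonneg _)]
        exact (mul_le_of_le_one_left (abs_nonneg _) (cut_le _)).trans (hs₂.trans h)
    rw [cut_one _ (by linarith), Complex.ofReal_one, one_mul] at hzs
    rw [hzs, hs] at hz
    exact (sub_left_inj.1 hz).symm
  · filter_upwards [Metric.ball_mem_nhds (0 : ℂ) (show (0 : ℝ) < ‖s‖ by positivity),
      Metric.ball_mem_nhds (0 : ℂ) (show (0 : ℝ) < 1 / 16 by norm_num)] with z hz hz'
    rw [mem_ball_zero_iff] at hz hz'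
    have hsz : s + z ≠ 0 := fun h0 => by
      rw [eq_neg_of_add_eq_zero_right h0, norm_neg] at hz
      exact hz.false
    have hp : a + Torus2.proj z - b = Torus2.proj (s + z) := by
      rw [Torus2.proj_add, hs]; abel
    have h1 : |(s + z).re| ≤ 1 / 8 := by
      rw [Complex.add_re]
      linarith [abs_add_le s.re z.re, Complex.abs_re_le_norm z]
    have h2 : |(s + z).im| ≤ 1 / 8 := by
      rw [Complex.add_im]
      linarith [abs_add_le s.im z.im, Complex.abs_im_le_norm z]
    simp only [ψ]
    rw [hp, cut_one _ (Torus2.norm_proj_le (by norm_num) h1 h2),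
      Torus2.chart_proj (by linarith) (by linarith), Complex.ofReal_one, one_mul]
    field_simp
    ring

/-- A nonvanishing complex function on the circle is a power of the coordinate times an
exponential. -/
lemma Circ.exists_eq_zpow_mul_exp (φ : C(Circ, ℂ)) (hφ : ∀ t, φ t ≠ 0) :
    ∃ (k : ℤ) (w : C(Circ, ℂ)),
      ∀ t : Circ, φ t = (AddCircle.toCircle t : ℂ) ^ k * Complex.exp (w t) := by
  have hne : ∀ t, ‖φ t‖ ≠ 0 := fun t => norm_ne_zero_iff.2 (hφ t)
  have hmem : ∀ t, φ t / (‖φ t‖ : ℂ) ∈ Submonoid.unitSphere ℂ := fun t => by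
    refine mem_sphere_zero_iff_norm.2 ?_
    rw [norm_div, Complex.norm_real, norm_norm, div_self (hne t)]
  have hcont : Continuous fun t => φ t / (‖φ t‖ : ℂ) :=
    φ.continuous.div (by fun_prop) fun t => Complex.ofReal_ne_zero.2 (hne t)
  let u : C(Circ, Circle) := ⟨fun t => ⟨φ t / ‖φ t‖, hmem t⟩, hcont.subtype_mk hmem⟩
  let hom := AddCircle.homeomorphCircle (T := (1 : ℝ)) one_ne_zero
  obtain ⟨k, g, hg⟩ := Circ.exists_degree (ContinuousMap.comp hom.symm u)
  have hu : ∀ t, u t = AddCircle.toCircle t ^ k * Circle.exp (2 * Real.pi * g t) := fun t => by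
    have h1 : hom (hom.symm (u t)) = u t := hom.apply_symm_apply _
    have h2 : hom.symm (u t) = k • t + ((g t : ℝ) : Circ) := hg t
    rw [h2, AddCircle.homeomorphCircle_apply, AddCircle.toCircle_add, AddCircle.toCircle_zsmul,
      AddCircle.toCircle_apply_mk, div_one] at h1
    exact h1.symm
  refine ⟨k, ⟨fun t => (Real.log ‖φ t‖ : ℝ) + (2 * Real.pi * g t : ℝ) * Complex.I, by
    have : Continuous fun t => Real.log ‖φ t‖ := Continuous.log (by fun_prop) hne
    fun_prop⟩, fun t => ?_⟩
  have h := congrArg (fun c : Circle => (c : ℂ)) (hu t)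
  simp only [Circle.coe_mul, Circle.coe_zpow, Circle.coe_exp] at h
  change φ t / ‖φ t‖ = _ at h
  rw [div_eq_iff (Complex.ofReal_ne_zero.2 (hne t))] at h
  simp only [ContinuousMap.coe_mk]
  rw [Complex.exp_add, ← Complex.ofReal_exp, Real.exp_log (norm_pos_iff.2 (hφ t))]
  exact h.trans (by ring)

/-- The values of two functions that agree on the intersection of two closed sets covering the
space can be pasted together. -/
lemma ContinuousMap.exists_paste {X Y : Type*} [TopologicalSpace X] [TopologicalSpace Y]
    {A B : Set X} (hA : IsClosed A) (hB : IsClosed B) (hAB : A ∪ B = Set.univ) {f g : X → Y}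
    (hf : ContinuousOn f A) (hg : ContinuousOn g B) (hfg : ∀ p ∈ A ∩ B, f p = g p) :
    ∃ h : C(X, Y), (∀ p ∈ A, h p = f p) ∧ ∀ p ∈ B, h p = g p := by
  classical
  have h1 : ∀ p ∈ A, (if p ∈ A then f p else g p) = f p := fun p hp => if_pos hp
  have h2 : ∀ p ∈ B, (if p ∈ A then f p else g p) = g p := fun p hp => by
    split_ifs with h
    · exact hfg p ⟨h, hp⟩
    · rfl
  have hc := (hf.congr h1).union_of_isClosed (hg.congr h2) hA hB
  rw [hAB, continuousOn_univ] at hc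
  exact ⟨⟨_, hc⟩, h1, h2⟩

/-- An embedded circle on which some circle-valued function has positive degree does not locally
separate the torus into two pieces that are globally distinct. -/
lemma Torus2.not_separates {A B : Set Torus2} (hA : IsClosed A) (hB : IsClosed B)
    (hAB : A ∪ B = Set.univ) (e : C(Circ, Torus2)) (he : Function.Injective e)
    (hC : A ∩ B ⊆ Set.range e) {c : Torus2} (hcA : c ∈ closure (A \ Set.range e))
    (hcB : c ∈ closure (B \ Set.range e)) (f : C(Torus2, Circ)) (m : ℕ) (hm : m ≠ 0)
    (g : C(Circ, ℝ)) (hf : ∀ t, f (e t) = m • t + ((g t : ℝ) : Circ)) : False := by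
  obtain ⟨a, ⟨haA, haC⟩, hca⟩ := Metric.mem_closure_iff.1 hcA (1 / 64) (by norm_num)
  obtain ⟨b, ⟨hbB, hbC⟩, hcb⟩ := Metric.mem_closure_iff.1 hcB (1 / 64) (by norm_num)
  have haB : a ∉ B := fun h => haC (hC ⟨haA, h⟩)
  have hbA : b ∉ A := fun h => hbC (hC ⟨h, hbB⟩)
  have hab : a ≠ b := fun h => hbA (h ▸ haA)
  have hnorm : ‖a - b‖ ≤ 1 / 32 := by
    rw [← dist_eq_norm]
    linarith [dist_triangle_left a b c]
  obtain ⟨ψ, s, hs, hψc, hψ, hψl⟩ := Torus2.exists_zero_pole hab hnorm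
  have hψe : ∀ t, ψ (e t) ≠ 0 := fun t h => haC ⟨t, hψ _ h⟩
  obtain ⟨k, w, hw⟩ := Circ.exists_eq_zpow_mul_exp
    ⟨fun t => ψ (e t), hψc.comp_continuous e.continuous fun t h => hbC ⟨t, h⟩⟩ hψe
  have hemb : Topology.IsClosedEmbedding e := e.continuous.isClosedEmbedding he
  obtain ⟨W, hW⟩ := ContinuousMap.exists_extension' hemb
    (⟨fun t => m * w t - k * ((2 * Real.pi * g t : ℝ) * Complex.I), by fun_prop⟩ : C(Circ, ℂ))
  let E : Torus2 → ℂ := fun p => (AddCircle.toCircle (f p) : ℂ)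
  have hE : Continuous E := 
    continuous_subtype_val.comp (AddCircle.continuous_toCircle.comp f.continuous)
  have hE0 : ∀ p, E p ≠ 0 := fun p => Circle.coe_ne_zero _
  have hEk : Continuous fun p => E p ^ (-k) := hE.zpow₀ _ fun p => Or.inl (hE0 p)
  have hEe : ∀ t, E (e t) = (AddCircle.toCircle t : ℂ) ^ m *
      Complex.exp ((2 * Real.pi * g t : ℝ) * Complex.I) := fun t => by
    simp only [E]
    rw [hf, AddCircle.toCircle_add, AddCircle.toCircle_nsmul, AddCircle.toCircle_apply_mk,
      div_one, Circle.coe_mul, Circle.coe_pow, Circle.coe_exp]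
  obtain ⟨Ξ, hΞA, hΞB⟩ := ContinuousMap.exists_paste hA hB hAB
    (f := fun p => ψ p ^ m * (E p ^ (-k) * Complex.exp (-W p))) (g := fun _ => 1)
    (((hψc.mono fun p hp => by rintro rfl; exact hbA hp).pow m).mul
      (by fun_prop)) continuousOn_const (by
      intro p hp
      obtain ⟨t, rfl⟩ := hC hp
      have h1 : ψ (e t) = (AddCircle.toCircle t : ℂ) ^ k * Complex.exp (w t) := hw t
      have h2 : W (e t) = m * w t - k * ((2 * Real.pi * g t : ℝ) * Complex.I) := congrFun hW t
      have h3 : (AddCircle.toCircle t : ℂ) ≠ 0 := Circle.coe_ne_zero _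
      rw [h1, h2, hEe, mul_pow, mul_zpow, ← Complex.exp_nat_mul, ← Complex.exp_int_mul,
        ← zpow_natCast, ← zpow_natCast, ← zpow_mul, ← zpow_mul]
      rw [show ∀ x y u v z : ℂ, x * y * (u * v * z) = (x * u) * (y * v * z) by intros; ring,
        ← zpow_add₀ h3, ← Complex.exp_add, ← Complex.exp_add]
      rw [show k * (m : ℤ) + m * -k = 0 by ring, zpow_zero, one_mul, ← Complex.exp_zero]
      congr 1
      push_cast
      ring)
  have hΞ0 : ∀ p, Ξ p = 0 → p = a := fun p hp => by
    have hp' : p ∈ A ∪ B := hAB ▸ Set.mem_univ p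
    rcases hp' with hpA | hpB
    · rw [hΞA p hpA] at hp
      have h := mul_eq_zero.1 hp
      rcases h with h | h
      · exact hψ p (pow_eq_zero_iff hm |>.1 h)
      · exact absurd h (mul_ne_zero (zpow_ne_zero _ (hE0 p)) (Complex.exp_ne_zero _))
    · rw [hΞB p hpB] at hp
      exact absurd hp one_ne_zero
  have hpr := Torus2.continuous_proj
  refine hm (Complex.index_eq_zero_of_periodic (X := fun z => Ξ (a + Torus2.proj z))
    (U₀ := fun z => (1 / (s + z)) ^ m *
      (E (a + Torus2.proj z) ^ (-k) * Complex.exp (-W (a + Torus2.proj z))))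
    (by fun_prop) (fun z => by rw [Torus2.proj_add, Torus2.proj_one, add_zero])
    (fun z => by rw [Torus2.proj_add, Torus2.proj_I, add_zero]) ?_ m ?_ ?_ ?_)
  · intro z h1 h2 hz h0
    have h := hΞ0 _ h0
    rw [add_eq_left] at h
    have h3 : ‖((z.re : ℝ) : Circ)‖ = 0 := by
      rw [show ((z.re : ℝ) : Circ) = 0 from congrArg Prod.fst h, norm_zero]
    have h4 : ‖((z.im : ℝ) : Circ)‖ = 0 := by
      rw [show ((z.im : ℝ) : Circ) = 0 from congrArg Prod.snd h, norm_zero]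
    rw [Circ.norm_coe h1, abs_eq_zero] at h3
    rw [Circ.norm_coe h2, abs_eq_zero] at h4
    exact hz (Complex.ext h3 h4)
  · have h1 : ContinuousAt (fun z : ℂ => 1 / (s + z)) 0 :=
      continuousAt_const.div (by fun_prop) (by simpa using hs)
    have h2 : Continuous fun z : ℂ => E (a + Torus2.proj z) ^ (-k) :=
      hEk.comp (continuous_const.add hpr)
    fun_prop
  · exact mul_ne_zero (pow_ne_zero _ (by simpa using hs))
      (mul_ne_zero (zpow_ne_zero _ (hE0 _)) (Complex.exp_ne_zero _))
  · have hev : ∀ᶠ z in 𝓝 (0 : ℂ), a + Torus2.proj z ∈ Bᶜ := by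
      have hc : Continuous fun z => a + Torus2.proj z := by fun_prop
      exact (hB.isOpen_compl.preimage hc).mem_nhds (by simpa [Torus2.proj, Prod.mk_zero_zero] using haB)
    filter_upwards [hev, hψl] with z hz hl
    have hzA : a + Torus2.proj z ∈ A := by
      have h : a + Torus2.proj z ∈ A ∪ B := hAB ▸ Set.mem_univ _
      exact h.resolve_right hz
    rw [hΞA _ hzA]
    rw [hl]
    ring

end Separation

section Bipartition

/-- The circle-valued function induced by a real-valued one. -/
def Circ.ofReal {X : Type*} [TopologicalSpace X] (G : C(X, ℝ)) : C(X, Circ) :=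
  ⟨fun p => (G p : Circ), AddCircle.continuous_coe.comp G.continuous⟩

namespace Torus2

lemma hasClass_fst : HasClass ContinuousMap.fst 1 0 := ⟨0, fun p => by simp⟩

lemma hasClass_snd : HasClass ContinuousMap.snd 0 1 := ⟨0, fun p => by simp⟩

lemma hasClass_ofReal (G : C(Torus2, ℝ)) : HasClass (Circ.ofReal G) 0 0 :=
  ⟨G, fun p => by simp [Circ.ofReal]⟩

lemma HasClass.sub {f f' : C(Torus2, Circ)} {a b c d : ℤ} (hf : HasClass f a b)
    (hf' : HasClass f' c d) : HasClass (f - f') (a - c) (b - d) := by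
  obtain ⟨g, hg⟩ := hf
  obtain ⟨g', hg'⟩ := hf'
  refine ⟨g - g', fun p => ?_⟩
  rw [ContinuousMap.sub_apply, ContinuousMap.sub_apply, hg, hg', AddCircle.coe_sub, sub_zsmul,
    sub_zsmul]
  abel

lemma HasClass.exists_lift {f : C(Torus2, Circ)} (hf : HasClass f 0 0) :
    ∃ g : C(Torus2, ℝ), ∀ p, f p = ((g p : ℝ) : Circ) := by
  obtain ⟨g, hg⟩ := hf
  exact ⟨g, fun p => by simpa using hg p⟩

lemma liftsOn_of_eq_zero {f : C(Torus2, Circ)} {s : Set Torus2} (h : ∀ p ∈ s, f p = 0) :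
    LiftsOn f s := ⟨0, fun p hp => by simpa using h p hp⟩

lemma liftsOn_of_norm_sub_le {f : C(Torus2, Circ)} (F : C(Torus2, ℝ)) :
    LiftsOn f {p | ‖f p - ((F p : ℝ) : Circ)‖ ≤ 1 / 4} := by
  have h1 := Circ.continuous_tri
  have h2 := AddCircle.continuous_coe
  refine ⟨⟨fun p => F p + Circ.tri (f p - ((F p : ℝ) : Circ)), by fun_prop⟩, fun p hp => ?_⟩
  change f p = ((F p + Circ.tri (f p - ((F p : ℝ) : Circ)) : ℝ) : Circ)
  rw [AddCircle.coe_add, Circ.coe_tri hp]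
  abel

/-- A circle-valued function supported in an open set without essential loops has class zero. -/
lemma HasClass.eq_zero_of_support {X : Set Torus2} (hX : IsOpen X)
    (hl : ∀ ℓ : C(Circ, Torus2), Set.range ℓ ⊆ X → ℓ.Nullhomotopic) {h : C(Torus2, Circ)}
    (h0 : ∀ p ∉ X, h p = 0) {a b : ℤ} (hc : HasClass h a b) : a = 0 ∧ b = 0 := by
  have hN : LiftsOn h {p | ‖h p‖ ≤ 1 / 4} := by
    simpa using liftsOn_of_norm_sub_le (f := h) 0
  have hcov : {p | ‖h p‖ ≤ 1 / 4} ∪ {p | 1 / 4 ≤ ‖h p‖} = Set.univ :=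
    Set.eq_univ_of_forall fun p => (le_total ‖h p‖ (1 / 4)).imp id id
  have : LocallyPathConnectedSpace Circ :=
    (isQuotientMap_quotient_mk' (X := ℝ)).locallyPathConnectedSpace
  have hL : ∀ f : C(Torus2, Circ), LiftsOn f {p | 1 / 4 ≤ ‖h p‖} := fun f =>
    Circ.exists_lift_of_isClosed_subset hX (isClosed_le continuous_const (by fun_prop))
      (fun p hp => by
        by_contra hpX
        rw [Set.mem_ofPred_eq, h0 p hpX, norm_zero] at hp
        norm_num at hp) f
      fun ℓ hℓ => Circ.exists_lift_of_nullhomotopic ((hl ℓ hℓ).comp_right f)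
  have h1 := hc.mul_eq_mul hasClass_fst hcov hN (hL _)
  have h2 := hc.mul_eq_mul hasClass_snd hcov hN (hL _)
  constructor <;> linarith

/-- Lifts over disjoint closed sets combine. -/
lemma LiftsOn.union {f : C(Torus2, Circ)} {s t : Set Torus2} (hs : IsClosed s) (ht : IsClosed t)
    (hst : Disjoint s t) (h₁ : LiftsOn f s) (h₂ : LiftsOn f t) : LiftsOn f (s ∪ t) := by
  obtain ⟨g, hg⟩ := h₁
  obtain ⟨g', hg'⟩ := h₂
  obtain ⟨χ, h0, h1, -⟩ := exists_continuous_zero_one_of_isClosed hs ht hst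
  refine ⟨(1 - χ) * g + χ * g', fun p hp => ?_⟩
  rcases hp with hp | hp
  · simp [hg p hp, h0 hp]
  · simp [hg' p hp, h1 hp]

lemma liftsOn_range {e : C(Circ, Torus2)} (he : Function.Injective e) {f : C(Torus2, Circ)}
    (hf : (f.comp e).Nullhomotopic) : LiftsOn f (Set.range e) := by
  obtain ⟨g, hg⟩ := Circ.exists_lift_of_nullhomotopic hf
  obtain ⟨W, hW⟩ := ContinuousMap.exists_extension' (e.continuous.isClosedEmbedding he) g
  refine ⟨W, ?_⟩
  rintro _ ⟨t, rfl⟩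
  rw [show W (e t) = g t from congrFun hW t]
  exact hg t

lemma isClosed_biUnion_range {ι : Type*} (s : Finset ι) (e : ι → C(Circ, Torus2)) :
    IsClosed (⋃ i ∈ s, Set.range (e i)) :=
  isClosed_biUnion_finset fun i _ => (isCompact_range (e i).continuous).isClosed

lemma liftsOn_biUnion_range {ι : Type*} (s : Finset ι) {e : ι → C(Circ, Torus2)}
    (he : ∀ i, Function.Injective (e i))
    (hpair : Pairwise fun i j => Disjoint (Set.range (e i)) (Set.range (e j)))
    {f : C(Torus2, Circ)} (hf : ∀ i ∈ s, (f.comp (e i)).Nullhomotopic) :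
    LiftsOn f (⋃ i ∈ s, Set.range (e i)) := by
  classical
  induction s using Finset.induction_on with
  | empty => exact liftsOn_of_eq_zero fun p hp => by simp at hp
  | insert i s hi ih =>
    rw [Finset.set_biUnion_insert]
    refine (liftsOn_range (he i) (hf i (Finset.mem_insert_self _ _))).union
      (isCompact_range (e i).continuous).isClosed (isClosed_biUnion_range s e) ?_
      (ih fun j hj => hf j (Finset.mem_insert_of_mem hj))
    refine Set.disjoint_iUnion₂_right.2 fun j hj => hpair ?_
    rintro rfl
    exact hi hj

/-- Some coordinate function has positive degree, up to sign, along an essential loop. -/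
lemma exists_degree_of_not_nullhomotopic {e : C(Circ, Torus2)} (he : ¬e.Nullhomotopic) :
    ∃ (f : C(Torus2, Circ)) (m : ℕ) (g : C(Circ, ℝ)), m ≠ 0 ∧
      ∀ t, f (e t) = m • t + ((g t : ℝ) : Circ) := by
  have key : ∀ (f : C(Torus2, Circ)) (k : ℤ) (g : C(Circ, ℝ)), k ≠ 0 →
      (∀ t, f (e t) = k • t + ((g t : ℝ) : Circ)) →
      ∃ (f : C(Torus2, Circ)) (m : ℕ) (g : C(Circ, ℝ)), m ≠ 0 ∧
        ∀ t, f (e t) = m • t + ((g t : ℝ) : Circ) := by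
    intro f k g hk h
    obtain ⟨m, rfl | rfl⟩ := k.eq_nat_or_neg
    · exact ⟨f, m, g, by simpa using hk, fun t => by simpa using h t⟩
    · refine ⟨-f, m, -g, by simpa using hk, fun t => ?_⟩
      rw [ContinuousMap.neg_apply, h, ContinuousMap.neg_apply, AddCircle.coe_neg]
      simp [add_comm]
  obtain ⟨k, g, hg⟩ := Circ.exists_degree (ContinuousMap.fst.comp e)
  obtain ⟨k', g', hg'⟩ := Circ.exists_degree (ContinuousMap.snd.comp e)
  by_cases hk : k = 0
  · by_cases hk' : k' = 0
    · refine absurd (nullhomotopic_of_lifts g.continuous g'.continuous (fun t => ?_) fun t => ?_) he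
      · simpa [hk] using hg t
      · simpa [hk'] using hg' t
    · exact key ContinuousMap.snd k' g' hk' hg'
  · exact key ContinuousMap.fst k g hk hg

/-- Disjoint open sets whose common frontier is a finite disjoint union of embedded circles and
which cover the torus together with it. -/
structure IsBipartition (X₁ X₂ : Set Torus2) {n : ℕ} (e : Fin n → C(Circ, Torus2)) : Prop where
  isOpen_left : IsOpen X₁
  isOpen_right : IsOpen X₂
  disjoint : Disjoint X₁ X₂
  frontier_eq : frontier X₁ = frontier X₂
  cover : X₁ ∪ X₂ ∪ frontier X₁ = Set.univ
  injective : ∀ i, Function.Injective (e i)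
  pairwise : Pairwise fun i j => Disjoint (Set.range (e i)) (Set.range (e j))
  frontier_eq_iUnion : frontier X₁ = ⋃ i, Set.range (e i)

namespace IsBipartition

variable {X₁ X₂ : Set Torus2} {n : ℕ} {e : Fin n → C(Circ, Torus2)}

lemma symm (h : IsBipartition X₁ X₂ e) : IsBipartition X₂ X₁ e where
  isOpen_left := h.isOpen_right
  isOpen_right := h.isOpen_left
  disjoint := h.disjoint.symm
  frontier_eq := h.frontier_eq.symm
  cover := by rw [← h.frontier_eq, Set.union_comm X₂]; exact h.cover
  injective := h.injective
  pairwise := h.pairwise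
  frontier_eq_iUnion := h.frontier_eq ▸ h.frontier_eq_iUnion

lemma compl_union_compl (h : IsBipartition X₁ X₂ e) : X₂ᶜ ∪ X₁ᶜ = Set.univ := by
  rw [← Set.compl_inter, Set.inter_comm, h.disjoint.inter_eq, Set.compl_empty]

lemma compl_inter_compl (h : IsBipartition X₁ X₂ e) : X₂ᶜ ∩ X₁ᶜ = frontier X₁ := by
  ext p
  constructor
  · rintro ⟨h2, h1⟩
    have hp : p ∈ X₁ ∪ X₂ ∪ frontier X₁ := h.cover ▸ Set.mem_univ p
    exact hp.resolve_left fun hp => hp.elim h1 h2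
  · intro hp
    refine ⟨fun h2 => ?_, fun h1 => ?_⟩
    · rw [h.frontier_eq, h.isOpen_right.frontier_eq] at hp
      exact hp.2 h2
    · rw [h.isOpen_left.frontier_eq] at hp
      exact hp.2 h1

/-- A cutoff equal to one on an essential boundary circle and to zero on the others defines an
essential circle-valued function. -/
lemma not_hasClass_zero (h : IsBipartition X₁ X₂ e) {i : Fin n} (hi : ¬(e i).Nullhomotopic)
    {G : C(Torus2, ℝ)} (hG1 : ∀ p ∈ Set.range (e i), G p = 1)
    (hG0 : ∀ j ≠ i, ∀ p ∈ Set.range (e j), G p = 0) {f : C(Torus2, Circ)}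
    (hfA : ∀ p ∈ X₂ᶜ, f p = ((G p : ℝ) : Circ)) (hfB : ∀ p ∈ X₁ᶜ, f p = 0) :
    ¬HasClass f 0 0 := by
  intro hf
  obtain ⟨g, hg⟩ := hf.exists_lift
  have hCK : Set.range (e i) ⊆ frontier X₁ :=
    h.frontier_eq_iUnion ▸ Set.subset_iUnion (fun j => Set.range (e j)) i
  have hCAB : Set.range (e i) ⊆ X₂ᶜ ∩ X₁ᶜ := h.compl_inter_compl ▸ hCK
  have hgA : ∀ p ∈ X₂ᶜ, ∃ k : ℤ, g p = G p + k := fun p hp =>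
    AddCircle.coe_sub_eq_zero_of_coe_eq ((hg p).symm.trans (hfA p hp))
  have hgB : ∀ p ∈ X₁ᶜ, ∃ k : ℤ, g p = k := fun p hp => by
    obtain ⟨k, hk⟩ := AddCircle.coe_sub_eq_zero_of_coe_eq (y := 0)
      ((hg p).symm.trans ((hfB p hp).trans (AddCircle.coe_zero _).symm))
    exact ⟨k, by simpa using hk⟩
  obtain ⟨m, hm⟩ := AddCircle.exists_int_of_coe_eq (f := fun t => g (e i t)) (g := fun _ => 0)
    (by fun_prop) continuous_const fun t => by
      rw [← hg, hfB _ (hCAB ⟨t, rfl⟩).2, AddCircle.coe_zero]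
  simp only [zero_add] at hm
  obtain ⟨f', d, w, hd, hf'⟩ := exists_degree_of_not_nullhomotopic hi
  have hX₁ := h.isOpen_left.isClosed_compl
  have hX₂ := h.isOpen_right.isClosed_compl
  refine not_separates (c := e i 0)
    (A := (X₂ᶜ ∩ {p | g p - G p ≤ m - 1}) ∪ (X₁ᶜ ∩ {p | g p ≤ m - 1}))
    (B := (X₂ᶜ ∩ {p | m ≤ g p - G p}) ∪ (X₁ᶜ ∩ {p | m ≤ g p}))
    ((hX₂.inter (isClosed_le (by fun_prop) continuous_const)).union
      (hX₁.inter (isClosed_le (by fun_prop) continuous_const)))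
    ((hX₂.inter (isClosed_le continuous_const (by fun_prop))).union
      (hX₁.inter (isClosed_le continuous_const (by fun_prop))))
    ?_ (e i) (h.injective i) ?_ ?_ ?_ f' d hd w hf'
  · refine Set.eq_univ_of_forall fun p => ?_
    have hp : p ∈ X₂ᶜ ∪ X₁ᶜ := h.compl_union_compl ▸ Set.mem_univ p
    rcases hp with hp | hp
    · obtain ⟨k, hk⟩ := hgA p hp
      rcases lt_or_ge k m with hkm | hkm
      · refine Or.inl (Or.inl ⟨hp, ?_⟩)
        have : (k : ℝ) + 1 ≤ m := by exact_mod_cast hkm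
        simp only [Set.mem_ofPred_eq]; linarith
      · refine Or.inr (Or.inl ⟨hp, ?_⟩)
        have : (m : ℝ) ≤ k := by exact_mod_cast hkm
        simp only [Set.mem_ofPred_eq]; linarith
    · obtain ⟨k, hk⟩ := hgB p hp
      rcases lt_or_ge k m with hkm | hkm
      · refine Or.inl (Or.inr ⟨hp, ?_⟩)
        have : (k : ℝ) + 1 ≤ m := by exact_mod_cast hkm
        simp only [Set.mem_ofPred_eq]; linarith
      · refine Or.inr (Or.inr ⟨hp, ?_⟩)
        have : (m : ℝ) ≤ k := by exact_mod_cast hkm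
        simp only [Set.mem_ofPred_eq]; linarith
  · have hAB : ∀ p ∈ X₂ᶜ, p ∈ X₁ᶜ → p ∉ Set.range (e i) → G p = 0 := fun p h2 h1 hp => by
      have hK : p ∈ ⋃ j, Set.range (e j) :=
        h.frontier_eq_iUnion ▸ h.compl_inter_compl ▸ ⟨h2, h1⟩
      obtain ⟨j, hj⟩ := Set.mem_iUnion.1 hK
      exact hG0 j (by rintro rfl; exact hp hj) p hj
    rintro p ⟨⟨h2, h3⟩ | ⟨h1, h3⟩, ⟨h2', h4⟩ | ⟨h1', h4⟩⟩ <;>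
      simp only [Set.mem_ofPred_eq] at h3 h4
    · linarith
    · by_contra hp
      linarith [hAB p h2 h1' hp]
    · by_contra hp
      linarith [hAB p h2' h1 hp]
    · linarith
  · have hc : e i 0 ∈ closure X₁ := frontier_subset_closure (hCK ⟨0, rfl⟩)
    have hO : IsOpen {p | g p - G p < m} := isOpen_lt (by fun_prop) continuous_const
    refine closure_mono ?_ (hO.inter_closure ⟨?_, hc⟩)
    · rintro p ⟨hp, hp1⟩
      refine ⟨Or.inl ⟨fun hp2 => h.disjoint.notMem_of_mem_left hp1 hp2, ?_⟩,
        fun hpC => (hCAB hpC).2 hp1⟩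
      obtain ⟨k, hk⟩ := hgA p fun hp2 => h.disjoint.notMem_of_mem_left hp1 hp2
      simp only [Set.mem_ofPred_eq, hk, add_sub_cancel_left] at hp ⊢
      have : k < m := by exact_mod_cast hp
      have : (k : ℝ) + 1 ≤ m := by exact_mod_cast this
      linarith
    · simp only [Set.mem_ofPred_eq, hm, hG1 _ ⟨0, rfl⟩]
      linarith
  · have hc : e i 0 ∈ closure X₂ := frontier_subset_closure (h.frontier_eq ▸ hCK ⟨0, rfl⟩)
    have hO : IsOpen {p | m - 1 < g p} := isOpen_lt continuous_const (by fun_prop)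
    refine closure_mono ?_ (hO.inter_closure ⟨?_, hc⟩)
    · rintro p ⟨hp, hp2⟩
      refine ⟨Or.inr ⟨fun hp1 => h.disjoint.notMem_of_mem_left hp1 hp2, ?_⟩,
        fun hpC => (hCAB hpC).1 hp2⟩
      obtain ⟨k, hk⟩ := hgB p fun hp1 => h.disjoint.notMem_of_mem_left hp1 hp2
      simp only [Set.mem_ofPred_eq, hk] at hp ⊢
      have : m < k + 1 := by exact_mod_cast sub_lt_iff_lt_add.1 hp
      exact_mod_cast Int.lt_add_one_iff.1 this
    · simp only [Set.mem_ofPred_eq, hm]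
      linarith

/-- Extension by zero of the circle-valued function induced by a cutoff. -/
lemma exists_extension_by_zero (h : IsBipartition X₁ X₂ e) {f : C(Torus2, Circ)}
    (hf : ∀ p ∈ frontier X₁, f p = 0) :
    ∃ f' : C(Torus2, Circ), (∀ p ∈ X₂ᶜ, f' p = f p) ∧ ∀ p ∈ X₁ᶜ, f' p = 0 :=
  ContinuousMap.exists_paste h.isOpen_right.isClosed_compl h.isOpen_left.isClosed_compl
    h.compl_union_compl f.continuous.continuousOn (g := fun _ => 0) continuousOn_const
    fun p hp => hf p (h.compl_inter_compl ▸ hp)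

lemma disjoint_biUnion_erase (h : IsBipartition X₁ X₂ e) (i : Fin n) :
    Disjoint (⋃ j ∈ Finset.univ.erase i, Set.range (e j)) (Set.range (e i)) :=
  Set.disjoint_iUnion₂_left.2 fun _ hj => h.pairwise (Finset.ne_of_mem_erase hj)

lemma mem_or_mem_of_mem_frontier (h : IsBipartition X₁ X₂ e) (i : Fin n) {p : Torus2}
    (hp : p ∈ frontier X₁) :
    p ∈ Set.range (e i) ∨ p ∈ ⋃ j ∈ Finset.univ.erase i, Set.range (e j) := by
  rw [h.frontier_eq_iUnion] at hp
  obtain ⟨j, hj⟩ := Set.mem_iUnion.1 hp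
  rcases eq_or_ne j i with rfl | hji
  · exact Or.inl hj
  · exact Or.inr (Set.mem_biUnion (Finset.mem_erase.2 ⟨hji, Finset.mem_univ j⟩) hj)

/-- With an essential boundary circle, each side contains an essential loop. -/
lemma not_forall_nullhomotopic (h : IsBipartition X₁ X₂ e) {i : Fin n}
    (hi : ¬(e i).Nullhomotopic) :
    ¬∀ ℓ : C(Circ, Torus2), Set.range ℓ ⊆ X₁ → ℓ.Nullhomotopic := by
  intro hl
  obtain ⟨G, hG0, hG1, -⟩ := exists_continuous_zero_one_of_isClosed
    (isClosed_biUnion_range (Finset.univ.erase i) e) (isCompact_range (e i).continuous).isClosed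
    (h.disjoint_biUnion_erase i)
  obtain ⟨f, hfA, hfB⟩ := h.exists_extension_by_zero (f := Circ.ofReal G) fun p hp => by
    rcases h.mem_or_mem_of_mem_frontier i hp with hp | hp
    · simp [Circ.ofReal, hG1 hp, AddCircle.coe_one_eq_zero]
    · simp [Circ.ofReal, hG0 hp]
  obtain ⟨a, b, hab⟩ := exists_hasClass f
  obtain ⟨rfl, rfl⟩ := hab.eq_zero_of_support h.isOpen_left hl hfB
  exact h.not_hasClass_zero hi (fun p hp => hG1 hp) (fun j hj p hp => hG0 <|
    Set.mem_biUnion (Finset.mem_erase.2 ⟨hj, Finset.mem_univ j⟩) hp) hfA hfB hab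

/-- Essential boundary circles come at least in pairs. -/
lemma exists_ne_not_nullhomotopic (h : IsBipartition X₁ X₂ e) {i : Fin n}
    (hi : ¬(e i).Nullhomotopic) : ∃ j, i ≠ j ∧ ¬(e j).Nullhomotopic := by
  by_contra! hnull
  set D := ⋃ j ∈ Finset.univ.erase i, Set.range (e j)
  have hlift : ∀ f : C(Torus2, Circ), LiftsOn f D := fun f =>
    liftsOn_biUnion_range _ h.injective h.pairwise fun j hj =>
      (hnull j (Finset.ne_of_mem_erase hj).symm).comp_right f
  obtain ⟨F, hF⟩ := hlift ContinuousMap.fst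
  obtain ⟨F', hF'⟩ := hlift ContinuousMap.snd
  have hco := AddCircle.continuous_coe
  have hclosed : ∀ (f : C(Torus2, Circ)) (F : C(Torus2, ℝ)),
      IsClosed {p | 1 / 4 ≤ ‖f p - ((F p : ℝ) : Circ)‖} := fun f F =>
    isClosed_le continuous_const (by fun_prop)
  have hdisj : ∀ (f : C(Torus2, Circ)) (F : C(Torus2, ℝ)), (∀ p ∈ D, f p = ((F p : ℝ) : Circ)) →
      Disjoint {p | 1 / 4 ≤ ‖f p - ((F p : ℝ) : Circ)‖} D := fun f F hF =>
    Set.disjoint_left.2 fun p hp hpD => by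
      rw [Set.mem_ofPred_eq, hF p hpD, sub_self, norm_zero] at hp
      norm_num at hp
  obtain ⟨G, hG0, hG1, -⟩ := exists_continuous_zero_one_of_isClosed
    ((isCompact_range (e i).continuous).isClosed.union
      ((hclosed ContinuousMap.fst F).union (hclosed ContinuousMap.snd F')))
    (isClosed_biUnion_range (Finset.univ.erase i) e)
    ((h.disjoint_biUnion_erase i).symm.union_left ((hdisj _ F hF).union_left (hdisj _ F' hF')))
  obtain ⟨f, hfA, hfB⟩ := h.exists_extension_by_zero (f := Circ.ofReal G) fun p hp => by
    rcases h.mem_or_mem_of_mem_frontier i hp with hp | hp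
    · simp [Circ.ofReal, hG0 (Or.inl hp)]
    · simp [Circ.ofReal, hG1 hp, AddCircle.coe_one_eq_zero]
  have hf0 : ∀ p, G p = 0 → f p = 0 := fun p hp => by
    have hp' : p ∈ X₂ᶜ ∪ X₁ᶜ := h.compl_union_compl ▸ Set.mem_univ p
    rcases hp' with hp' | hp'
    · rw [hfA p hp']; simp [Circ.ofReal, hp]
    · exact hfB p hp'
  obtain ⟨a, b, hab⟩ := exists_hasClass f
  have hcov : ∀ (f : C(Torus2, Circ)) (F : C(Torus2, ℝ)),
      {p | 1 / 4 ≤ ‖f p - ((F p : ℝ) : Circ)‖} ∪ {p | ‖f p - ((F p : ℝ) : Circ)‖ ≤ 1 / 4} =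
        Set.univ := fun f F => Set.eq_univ_of_forall fun p =>
          (le_total (1 / 4) ‖f p - ((F p : ℝ) : Circ)‖).imp id id
  have h1 := hab.mul_eq_mul hasClass_fst (hcov _ F)
    (liftsOn_of_eq_zero fun p hp => hf0 p (hG0 (Or.inr (Or.inl hp)))) (liftsOn_of_norm_sub_le F)
  have h2 := hab.mul_eq_mul hasClass_snd (hcov _ F')
    (liftsOn_of_eq_zero fun p hp => hf0 p (hG0 (Or.inr (Or.inr hp)))) (liftsOn_of_norm_sub_le F')
  obtain rfl : b = 0 := by linarith
  obtain rfl : a = 0 := by linarith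
  refine h.not_hasClass_zero hi (G := 1 - G) (f := Circ.ofReal 0 - f)
    (fun p hp => ?_) (fun j hj p hp => ?_) (fun p hp => ?_) (fun p hp => ?_)
    ((hasClass_ofReal 0).sub hab)
  · simp [hG0 (Or.inl hp)]
  · simp [hG1 (Set.mem_biUnion (Finset.mem_erase.2 ⟨hj, Finset.mem_univ j⟩) hp)]
  · simp [hfA p hp, Circ.ofReal, AddCircle.coe_one_eq_zero]
  · simp [hfB p hp, Circ.ofReal]

/-- If all boundary circles are contractible, exactly one side has only contractible loops. -/
lemma xor_of_forall_nullhomotopic (h : IsBipartition X₁ X₂ e)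
    (hnull : ∀ i, (e i).Nullhomotopic) :
    ((∀ ℓ : C(Circ, Torus2), Set.range ℓ ⊆ X₁ → ℓ.Nullhomotopic) ∧
      ¬∀ ℓ : C(Circ, Torus2), Set.range ℓ ⊆ X₂ → ℓ.Nullhomotopic) ∨
    ((¬∀ ℓ : C(Circ, Torus2), Set.range ℓ ⊆ X₁ → ℓ.Nullhomotopic) ∧
      ∀ ℓ : C(Circ, Torus2), Set.range ℓ ⊆ X₂ → ℓ.Nullhomotopic) := by
  have hsplit : ∀ (f : C(Torus2, Circ)) (c d : ℤ), HasClass f c d →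
      ∃ (F : C(Torus2, ℝ)) (f₁ f₂ : C(Torus2, Circ)) (a b : ℤ), HasClass f₁ a b ∧
        HasClass f₂ (c - a) (d - b) ∧ (∀ p ∈ X₁ᶜ, f₁ p = 0) ∧ (∀ p ∈ X₂ᶜ, f₂ p = 0) ∧
        ∀ p, f p = F p + f₁ p + f₂ p := by
    intro f c d hf
    obtain ⟨F, hF⟩ := liftsOn_biUnion_range Finset.univ h.injective h.pairwise
      (f := f) fun j _ => (hnull j).comp_right f
    obtain ⟨f₁, hA, hB⟩ := h.exists_extension_by_zero (f := f - Circ.ofReal F) fun p hp => by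
      rw [h.frontier_eq_iUnion] at hp
      simp [Circ.ofReal, hF p (by simpa using hp)]
    obtain ⟨a, b, hab⟩ := exists_hasClass f₁
    refine ⟨F, f₁, f - Circ.ofReal F - f₁, a, b, hab, ?_, hB, fun p hp => ?_, fun p => ?_⟩
    · simpa using (hf.sub (hasClass_ofReal F)).sub hab
    · simp [hA p hp]
    · simp [Circ.ofReal]
  obtain ⟨F, x₁, x₂, a, b, hx₁, hx₂, hx₁0, hx₂0, hx⟩ := hsplit _ 1 0 hasClass_fst
  obtain ⟨F', y₁, y₂, c, d, hy₁, hy₂, hy₁0, hy₂0, hy⟩ := hsplit _ 0 1 hasClass_snd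
  have hcov : X₁ᶜ ∪ X₂ᶜ = Set.univ := h.symm.compl_union_compl
  have e1 := hx₁.mul_eq_mul hx₂ hcov (liftsOn_of_eq_zero hx₁0) (liftsOn_of_eq_zero hx₂0)
  have e2 := hx₁.mul_eq_mul hy₂ hcov (liftsOn_of_eq_zero hx₁0) (liftsOn_of_eq_zero hy₂0)
  have e3 := hy₁.mul_eq_mul hx₂ hcov (liftsOn_of_eq_zero hy₁0) (liftsOn_of_eq_zero hx₂0)
  have e4 := hy₁.mul_eq_mul hy₂ hcov (liftsOn_of_eq_zero hy₁0) (liftsOn_of_eq_zero hy₂0)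
  obtain rfl : b = 0 := by linarith
  obtain rfl : c = 0 := by linarith
  have hnul : ∀ {X : Set Torus2} {u v : C(Torus2, ℝ)},
      (∀ p ∈ X, p.1 = ((u p : ℝ) : Circ)) → (∀ p ∈ X, p.2 = ((v p : ℝ) : Circ)) →
      ∀ ℓ : C(Circ, Torus2), Set.range ℓ ⊆ X → ℓ.Nullhomotopic := fun hu hv ℓ hℓ =>
    nullhomotopic_of_lifts (ContinuousMap.continuous (ContinuousMap.comp _ ℓ))
      (ContinuousMap.continuous (ContinuousMap.comp _ ℓ))
      (fun t => hu _ (hℓ ⟨t, rfl⟩)) fun t => hv _ (hℓ ⟨t, rfl⟩)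
  rcases eq_or_ne a 0 with rfl | ha
  · obtain rfl : d = 0 := by linarith
    obtain ⟨u, hu⟩ := hx₁.exists_lift
    obtain ⟨v, hv⟩ := hy₁.exists_lift
    refine Or.inl ⟨hnul (u := F + u) (v := F' + v) (fun p hp => ?_) fun p hp => ?_, fun hl => ?_⟩
    · have := hx p
      rw [hx₂0 p (h.disjoint.notMem_of_mem_left hp), hu] at this
      simpa using this
    · have := hy p
      rw [hy₂0 p (h.disjoint.notMem_of_mem_left hp), hv] at this
      simpa using this
    · have := (hx₂.eq_zero_of_support h.isOpen_right hl hx₂0).1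
      norm_num at this
  · obtain rfl : d = 1 := by
      have : a * (1 - d) = 0 := by linarith
      rcases mul_eq_zero.1 this with h' | h'
      · exact absurd h' ha
      · linarith
    obtain rfl : a = 1 := by linarith
    obtain ⟨u, hu⟩ := hx₂.exists_lift
    obtain ⟨v, hv⟩ := hy₂.exists_lift
    refine Or.inr ⟨fun hl => ?_, hnul (u := F + u) (v := F' + v) (fun p hp => ?_) fun p hp => ?_⟩
    · have := (hx₁.eq_zero_of_support h.isOpen_left hl hx₁0).1
      norm_num at this
    · have := hx p
      rw [hx₁0 p (h.disjoint.notMem_of_mem_right hp), hu] at this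
      simpa using this
    · have := hy p
      rw [hy₁0 p (h.disjoint.notMem_of_mem_right hp), hv] at this
      simpa using this

end IsBipartition

end Torus2

end Bipartition

/-- For a regular bipartition `(X₁, X₂)` of the 2-torus (disjoint open sets
with common boundary a finite disjoint union of embedded circles, covering the torus
together with the boundary), exactly one of the following holds:
(i) `π₁(X₁) → π₁(T²)` is trivial, (ii) `π₁(X₂) → π₁(T²)` is trivial,
(iii) the boundary has at least two components non-contractible in `T²`. -/
theorem stmt5 (X₁ X₂ : Set Torus2) (hX₁ : IsOpen X₁) (hX₂ : IsOpen X₂)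
    (hdisj : Disjoint X₁ X₂) (hfront : frontier X₁ = frontier X₂)
    (hcover : X₁ ∪ X₂ ∪ frontier X₁ = Set.univ)
    (n : ℕ) (e : Fin n → C(Circ, Torus2))
    (hinj : ∀ i, Function.Injective (e i))
    (hpair : Pairwise fun i j => Disjoint (Set.range (e i)) (Set.range (e j)))
    (hbd : frontier X₁ = ⋃ i, Set.range (e i)) :
    letI P₁ : Prop := ∀ ℓ : C(Circ, Torus2), Set.range ℓ ⊆ X₁ → ℓ.Nullhomotopic
    letI P₂ : Prop := ∀ ℓ : C(Circ, Torus2), Set.range ℓ ⊆ X₂ → ℓ.Nullhomotopic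
    letI P₃ : Prop := ∃ i j : Fin n, i ≠ j ∧ ¬(e i).Nullhomotopic ∧ ¬(e j).Nullhomotopic
    (P₁ ∧ ¬P₂ ∧ ¬P₃) ∨ (¬P₁ ∧ P₂ ∧ ¬P₃) ∨ (¬P₁ ∧ ¬P₂ ∧ P₃) := by
  have h : Torus2.IsBipartition X₁ X₂ e :=
    ⟨hX₁, hX₂, hdisj, hfront, hcover, hinj, hpair, hbd⟩
  by_cases hnull : ∀ i, (e i).Nullhomotopic
  · have hP₃ : ¬∃ i j : Fin n, i ≠ j ∧ ¬(e i).Nullhomotopic ∧ ¬(e j).Nullhomotopic := by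
      rintro ⟨i, -, -, hi, -⟩
      exact hi (hnull i)
    rcases h.xor_of_forall_nullhomotopic hnull with ⟨h1, h2⟩ | ⟨h1, h2⟩
    · exact Or.inl ⟨h1, h2, hP₃⟩
    · exact Or.inr (Or.inl ⟨h1, h2, hP₃⟩)
  · push Not at hnull
    obtain ⟨i, hi⟩ := hnull
    obtain ⟨j, hij, hj⟩ := h.exists_ne_not_nullhomotopic hi
    exact Or.inr (Or.inr ⟨h.not_forall_nullhomotopic hi, h.symm.not_forall_nullhomotopic hi,
      i, j, hij, hi, hj⟩)
end

section
/- Let (X1, X2) be a regular bipartition of T^2 such that there exist continuous loops c1 in X1 and c2 in X2, each non-contractible in T^2. Then at least one connected component of ∂X1 represents a nonzero class in H_1(T^2, Z); in fact ∂X1 has at least two components non-homologous to zero. -/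
/-- The covering projection `ℝ² → ℝ²/ℤ²`. -/
noncomputable def proj2 (p : ℝ × ℝ) : Torus2 := ((p.1 : Circ), (p.2 : Circ))

/-- A loop in the torus represents a nonzero class in `H₁(T², ℤ) ≅ ℤ²` iff its lift to
`ℝ²` translates by a nonzero integer vector after one period. -/
def NonzeroClass (ℓ : C(Circ, Torus2)) : Prop :=
  ∃ (L : ℝ → ℝ × ℝ) (w : ℤ × ℤ), Continuous L ∧
    (∀ t : ℝ, proj2 (L t) = ℓ (t : Circ)) ∧
    (∀ t : ℝ, L (t + 1) = L t + ((w.1 : ℝ), (w.2 : ℝ))) ∧ w ≠ 0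

open Filter Topology Complex

/-- `f` has a continuous logarithm on the set `J`. -/
def LogOn {X : Type*} [TopologicalSpace X] (J : Set X) (f : X → ℂ) : Prop :=
  ∃ g : X → ℂ, ContinuousOn g J ∧ ∀ x ∈ J, f x = exp (g x)

section LogOn

variable {X : Type*} [TopologicalSpace X] {J : Set X} {f g : X → ℂ}

theorem LogOn.congr (hf : LogOn J f) (h : ∀ x ∈ J, g x = f x) : LogOn J g := by
  obtain ⟨a, ha, hfa⟩ := hf
  exact ⟨a, ha, fun x hx => (h x hx).trans (hfa x hx)⟩

theorem LogOn.mul (hf : LogOn J f) (hg : LogOn J g) : LogOn J fun x => f x * g x := by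
  obtain ⟨a, ha, hfa⟩ := hf
  obtain ⟨b, hb, hgb⟩ := hg
  exact ⟨fun x => a x + b x, ha.add hb, fun x hx => by
    beta_reduce
    rw [hfa x hx, hgb x hx, Complex.exp_add]⟩

theorem LogOn.one : LogOn J fun _ => (1 : ℂ) :=
  ⟨fun _ => 0, continuousOn_const, by simp⟩

theorem LogOn.conj (hf : LogOn J f) : LogOn J fun x => (starRingEnd ℂ) (f x) := by
  obtain ⟨a, ha, hfa⟩ := hf
  exact ⟨fun x => (starRingEnd ℂ) (a x), Complex.continuous_conj.comp_continuousOn ha,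
    fun x hx => by beta_reduce; rw [hfa x hx, Complex.exp_conj]⟩

theorem LogOn.prod {ι : Type*} (s : Finset ι) {F : ι → X → ℂ} (h : ∀ i ∈ s, LogOn J (F i)) :
    LogOn J fun x => ∏ i ∈ s, F i x := by
  classical
  induction s using Finset.induction_on with
  | empty => simpa using LogOn.one
  | insert i s hi ih =>
    simp only [Finset.prod_insert hi]
    exact (h i (by simp)).mul (ih fun j hj => h j (by simp [hj]))

/-- A function close to `1` has a continuous logarithm. -/
theorem LogOn.of_norm_sub_one_lt (hf : ContinuousOn f J) (h : ∀ x ∈ J, ‖f x - 1‖ < 1) :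
    LogOn J f := by
  have hs : ∀ x ∈ J, f x ∈ slitPlane := fun x hx => by
    have := mem_slitPlane_of_norm_lt_one (h x hx)
    simpa using this
  exact ⟨fun x => log (f x), hf.clog hs, fun x hx => (exp_log (slitPlane_ne_zero (hs x hx))).symm⟩

end LogOn

/-- A nonvanishing function on a simply connected space has a continuous logarithm. -/
theorem exists_continuous_log {A : Type*} [TopologicalSpace A] [SimplyConnectedSpace A]
    [LocallyPathConnectedSpace A] {f : A → ℂ} (hf : Continuous f) (h0 : ∀ a, f a ≠ 0) :
    ∃ g : A → ℂ, Continuous g ∧ ∀ a, f a = exp (g a) := by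
  have a₀ : A := Classical.arbitrary A
  obtain ⟨g, ⟨-, hg⟩, -⟩ := isCoveringMap_exp.existsUnique_continuousMap_lifts
    (A := A) ⟨fun a => (⟨f a, h0 a⟩ : {z : ℂ // z ≠ 0}), by fun_prop⟩ a₀ (log (f a₀))
    (Subtype.ext (by simp [exp_log (h0 a₀)]))
  refine ⟨g, g.continuous, fun a => ?_⟩
  have := congrArg Subtype.val (congrFun hg a)
  exact this.symm

/-- A function without zeros in a square agrees on this square with the exponential of a
continuous function. -/
theorem exists_log_on_square {f : ℂ → ℂ} (hf : Continuous f) (p : ℂ) {R : ℝ} (hR : 0 ≤ R)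
    (h0 : ∀ z : ℂ, |z.re - p.re| ≤ R → |z.im - p.im| ≤ R → f z ≠ 0) :
    ∃ g : ℂ → ℂ, Continuous g ∧
      ∀ z : ℂ, |z.re - p.re| ≤ R → |z.im - p.im| ≤ R → f z = exp (g z) := by
  let cl : ℝ → ℝ → ℝ := fun a x => max (a - R) (min (a + R) x)
  have hcl : ∀ a x, |cl a x - a| ≤ R := fun a x => by
    rw [abs_le]
    constructor
    · linarith [le_max_left (a - R) (min (a + R) x)]
    · have : cl a x ≤ a + R := max_le (by linarith) (min_le_left _ _)
      linarith
  have hcl' : ∀ a x, |x - a| ≤ R → cl a x = x := fun a x h => by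
    rw [abs_le] at h
    have h1 : min (a + R) x = x := min_eq_right (by linarith)
    simp only [cl, h1]
    exact max_eq_right (by linarith)
  let r : ℂ → ℂ := fun z => cl p.re z.re + cl p.im z.im * I
  have hr : Continuous r := by
    have := Complex.continuous_re
    have := Complex.continuous_im
    simp only [r, cl]
    fun_prop
  obtain ⟨g, hg, hfg⟩ := exists_continuous_log (f := fun z => f (r z)) (hf.comp hr)
    (fun z => h0 _ (by simpa [r] using hcl _ _) (by simpa [r] using hcl _ _))
  refine ⟨g, hg, fun z h1 h2 => ?_⟩
  rw [← hfg z]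
  congr 1
  simp [r, hcl' _ _ h1, hcl' _ _ h2]

/-- If a compact set `J` misses an unbounded path, then `z - a` has a logarithm on `J` for every
point `a` of the path. -/
theorem logOn_sub_of_path {J : Set ℂ} (hJ : IsCompact J) {γ : ℝ → ℂ} (hγ : Continuous γ)
    (hd : ∀ t, γ t ∉ J) (hu : ∀ R : ℝ, ∃ t, R < ‖γ t‖) (t : ℝ) :
    LogOn J fun z => z - γ t := by
  have key : ∀ t, ∃ δ > 0, ∀ s, ‖γ s - γ t‖ < δ → LogOn J (fun z => z - γ t) →
      LogOn J fun z => z - γ s := by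
    intro t
    obtain ⟨δ, hδ, hball⟩ := Metric.isOpen_iff.1 hJ.isClosed.isOpen_compl (γ t) (hd t)
    refine ⟨δ, hδ, fun s hs hlog => ?_⟩
    have hne : ∀ z ∈ J, z - γ t ≠ 0 := fun z hz h =>
      hd t (by rwa [sub_eq_zero.1 h] at hz)
    refine (hlog.mul (LogOn.of_norm_sub_one_lt (f := fun z => (z - γ s) / (z - γ t)) ?_ ?_)).congr
      fun z hz => (mul_div_cancel₀ _ (hne z hz)).symm
    · exact ContinuousOn.div (by fun_prop) (by fun_prop) hne
    · intro z hz
      have h1 : (z - γ s) / (z - γ t) - 1 = (γ t - γ s) / (z - γ t) := by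
        field_simp [hne z hz]
        ring
      have h2 : δ ≤ ‖z - γ t‖ := by
        by_contra! h
        exact hball (by simpa [dist_eq_norm] using h) hz
      rw [h1, norm_div, div_lt_one (by linarith), norm_sub_rev]
      linarith
  have key' : ∀ t, ∃ δ > 0, ∀ s, ‖γ s - γ t‖ < δ → LogOn J (fun z => z - γ s) →
      LogOn J fun z => z - γ t := by
    intro t
    obtain ⟨δ, hδ, hball⟩ := Metric.isOpen_iff.1 hJ.isClosed.isOpen_compl (γ t) (hd t)
    refine ⟨δ / 2, by linarith, fun s hs hlog => ?_⟩
    have hne : ∀ z ∈ J, z - γ s ≠ 0 := fun z hz h =>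
      hd s (by rwa [sub_eq_zero.1 h] at hz)
    refine (hlog.mul (LogOn.of_norm_sub_one_lt (f := fun z => (z - γ t) / (z - γ s)) ?_ ?_)).congr
      fun z hz => (mul_div_cancel₀ _ (hne z hz)).symm
    · exact ContinuousOn.div (by fun_prop) (by fun_prop) hne
    · intro z hz
      have h1 : (z - γ t) / (z - γ s) - 1 = (γ s - γ t) / (z - γ s) := by
        field_simp [hne z hz]
        ring
      have h2 : δ ≤ ‖z - γ t‖ := by
        by_contra! h
        exact hball (by simpa [dist_eq_norm] using h) hz
      have h3 : ‖z - γ t‖ ≤ ‖z - γ s‖ + ‖γ s - γ t‖ := norm_sub_le_norm_sub_add_norm_sub z (γ s) (γ t)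
      rw [h1, norm_div, div_lt_one (by linarith)]
      linarith
  have hopen : IsOpen {t | LogOn J fun z => z - γ t} := by
    rw [Metric.isOpen_iff]
    intro t ht
    obtain ⟨δ, hδ, h⟩ := key t
    obtain ⟨ε, hε, h'⟩ := Metric.continuous_iff.1 hγ t δ hδ
    exact ⟨ε, hε, fun s hs => h s (by simpa [dist_eq_norm] using h' s hs) ht⟩
  have hclosed : IsClosed {t | LogOn J fun z => z - γ t} := by
    rw [← isOpen_compl_iff, Metric.isOpen_iff]
    intro t ht
    obtain ⟨δ, hδ, h⟩ := key' t
    obtain ⟨ε, hε, h'⟩ := Metric.continuous_iff.1 hγ t δ hδ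
    exact ⟨ε, hε, fun s hs hs' => ht (h s (by simpa [dist_eq_norm] using h' s hs) hs')⟩
  have hne : {t | LogOn J fun z => z - γ t}.Nonempty := by
    obtain ⟨R, hR⟩ := hJ.isBounded.exists_norm_le
    obtain ⟨t, ht⟩ := hu (max R 0)
    have hR' := (le_max_left _ _).trans_lt ht
    have h0 : 0 < ‖γ t‖ := (le_max_right _ _).trans_lt ht
    have h0' : γ t ≠ 0 := norm_pos_iff.1 h0
    refine ⟨t, (LogOn.mul (f := fun _ => - γ t) (g := fun z => 1 - z / γ t)
      ⟨fun _ => log (-γ t), continuousOn_const, fun _ _ => (exp_log (neg_ne_zero.2 h0')).symm⟩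
      (LogOn.of_norm_sub_one_lt (by fun_prop) fun z hz => ?_)).congr fun z _ => ?_⟩
    · have : 1 - z / γ t - 1 = - (z / γ t) := by ring
      rw [this, norm_neg, norm_div, div_lt_one h0]
      exact (hR z hz).trans_lt hR'
    · field_simp
      ring
  exact (IsClopen.eq_univ ⟨hclosed, hopen⟩ hne).ge (Set.mem_univ t)

/-- Finitely many isolated zeros with prescribed leading behaviour can be divided out. -/
theorem exists_factor {lin : ℂ → ℂ → ℂ} (hlin : ∀ a, Continuous (lin a))
    (hlin0 : ∀ a z, lin a z = 0 ↔ z = a) (Z : Finset ℂ) :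
    ∀ F : ℂ → ℂ, Continuous F →
      (∀ a ∈ Z, F a = 0 ∧ ∃ c ≠ 0, Tendsto (fun z => F z / lin a z) (𝓝[≠] a) (𝓝 c)) →
      ∃ h : ℂ → ℂ, Continuous h ∧ (∀ z, F z = h z * ∏ a ∈ Z, lin a z) ∧ ∀ a ∈ Z, h a ≠ 0 := by
  classical
  induction Z using Finset.induction_on with
  | empty => exact fun F hF _ => ⟨F, hF, by simp, by simp⟩
  | insert a Z ha ih =>
    intro F hF hZ
    obtain ⟨hFa, c, hc, hac⟩ := hZ a (by simp)
    let k : ℂ → ℂ := Function.update (fun z => F z / lin a z) a c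
    have hk : ∀ z, z ≠ a → k z = F z / lin a z := fun z hz => by simp [k, hz]
    have hka : k a = c := by simp [k]
    have hkF : ∀ z, F z = k z * lin a z := fun z => by
      by_cases hz : z = a
      · subst hz
        rw [hFa, (hlin0 _ _).2 rfl, mul_zero]
      · rw [hk z hz, div_mul_cancel₀ _ (mt (hlin0 a z).1 hz)]
    have hkc : Continuous k := by
      rw [continuous_iff_continuousAt]
      intro z
      by_cases hz : z = a
      · subst hz
        exact continuousAt_update_same.2 hac
      · have h1 : ContinuousAt (fun z => F z / lin a z) z :=
          hF.continuousAt.div (hlin a).continuousAt (mt (hlin0 a z).1 hz)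
        refine h1.congr ?_
        filter_upwards [isOpen_ne.mem_nhds hz] with w hw using (hk w hw).symm
    obtain ⟨h, hh, hfac, hne⟩ := ih k hkc fun b hb => by
      have hba : b ≠ a := fun h => ha (h ▸ hb)
      obtain ⟨hFb, d, hd, hbd⟩ := hZ b (by simp [hb])
      have hla : lin a b ≠ 0 := mt (hlin0 a b).1 hba
      refine ⟨by rw [hk b hba, hFb, zero_div], d / lin a b, div_ne_zero hd hla, ?_⟩
      have h1 : Tendsto (fun z => F z / lin b z / lin a z) (𝓝[≠] b) (𝓝 (d / lin a b)) :=
        hbd.div (((hlin a).tendsto b).mono_left nhdsWithin_le_nhds) hla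
      refine h1.congr' ?_
      filter_upwards [nhdsWithin_le_nhds (isOpen_ne.mem_nhds hba)] with z hz
      rw [hk z hz, div_right_comm]
    refine ⟨h, hh, fun z => ?_, fun b hb => ?_⟩
    · rw [hkF, hfac, Finset.prod_insert ha]
      ring
    · rcases Finset.mem_insert.1 hb with rfl | hb
      · intro h0
        apply hc
        rw [← hka, hfac, h0, zero_mul]
      · exact hne b hb

/-- A function has a logarithm on a compact set as soon as the factors corresponding to its zeros
do. -/
theorem logOn_of_zeros {F : ℂ → ℂ} (hF : Continuous F) {J : Set ℂ} (hJ : IsCompact J)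
    (h : ∀ a, F a = 0 → ∃ l : ℂ → ℂ, Continuous l ∧ (∀ z, l z = 0 ↔ z = a) ∧ LogOn J l ∧
      ∃ c ≠ 0, Tendsto (fun z => F z / l z) (𝓝[≠] a) (𝓝 c)) : LogOn J F := by
  have h' : ∀ a, ∃ l : ℂ → ℂ, Continuous l ∧ (∀ z, l z = 0 ↔ z = a) ∧ (F a = 0 → LogOn J l ∧
      ∃ c ≠ 0, Tendsto (fun z => F z / l z) (𝓝[≠] a) (𝓝 c)) := fun a => by
    by_cases ha : F a = 0
    · obtain ⟨l, h1, h2, h3⟩ := h a ha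
      exact ⟨l, h1, h2, fun _ => h3⟩
    · exact ⟨fun z => z - a, by fun_prop, fun z => sub_eq_zero, fun h => absurd h ha⟩
  choose lin hlin hlin0 hlinF using h'
  obtain ⟨R, hR⟩ := hJ.isBounded.exists_norm_le
  have hfin : (Metric.closedBall (0 : ℂ) (2 * |R|) ∩ {z | F z = 0}).Finite := by
    refine (isCompact_closedBall (0 : ℂ) (2 * |R|)).induction_on
      (p := fun s => (s ∩ {z | F z = 0}).Finite) (by simp)
      (fun s t hst ht => ht.subset (Set.inter_subset_inter_left _ hst))
      (fun s t hs ht => by rw [Set.union_inter_distrib_right]; exact hs.union ht) fun a _ => ?_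
    by_cases ha : F a = 0
    · obtain ⟨c, hc, hac⟩ := (hlinF a ha).2
      have hev := hac.eventually (isOpen_ne.mem_nhds hc)
      rw [eventually_nhdsWithin_iff] at hev
      refine ⟨_, mem_nhdsWithin_of_mem_nhds hev, (Set.finite_singleton a).subset ?_⟩
      rintro z ⟨hz, hz0⟩
      by_contra hza
      have := hz hza
      have hz0' : F z = 0 := hz0
      simp [hz0'] at this
    · refine ⟨_, mem_nhdsWithin_of_mem_nhds
        ((isOpen_ne_fun hF continuous_const).mem_nhds ha), ?_⟩
      convert Set.finite_empty
      ext z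
      simp +contextual
  obtain ⟨k, hk, hfac, hne⟩ := exists_factor hlin hlin0 hfin.toFinset F hF fun a ha => by
    have ha' : F a = 0 := (hfin.mem_toFinset.1 ha).2
    exact ⟨ha', (hlinF a ha').2⟩
  have hR' : ∀ x y : ℝ, |x| ≤ |R| → |y| ≤ |R| → (x + y * I : ℂ) ∈ Metric.closedBall (0 : ℂ) (2 * |R|) := by
    intro x y hx hy
    rw [mem_closedBall_zero_iff]
    calc ‖(x + y * I : ℂ)‖ ≤ ‖(x : ℂ)‖ + ‖(y * I : ℂ)‖ := norm_add_le _ _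
      _ = |x| + |y| := by simp
      _ ≤ 2 * |R| := by linarith
  obtain ⟨g, hg, hkg⟩ := exists_log_on_square hk 0 (abs_nonneg R) fun z h1 h2 h0 => by
    have hz : z ∈ hfin.toFinset := by
      rw [hfin.mem_toFinset]
      refine ⟨?_, by simp [hfac z, h0]⟩
      have := hR' z.re z.im (by simpa using h1) (by simpa using h2)
      rwa [re_add_im] at this
    exact hne z hz h0
  refine LogOn.congr (LogOn.mul (f := k) ⟨g, hg.continuousOn, fun z hz => hkg z ?_ ?_⟩
    (LogOn.prod hfin.toFinset (F := lin) fun a ha => (hlinF a (hfin.mem_toFinset.1 ha).2).1))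
    fun z _ => hfac z
  · simpa using (abs_re_le_norm z).trans ((hR z hz).trans (le_abs_self R))
  · simpa using (abs_im_le_norm z).trans ((hR z hz).trans (le_abs_self R))

/-- If the exponentials of `D` and of `k • L` differ by a constant sign `c`, then `D` and `k • L`
have the same total variation. -/
theorem sub_eq_of_exp_eq {D L : ℝ → ℂ} {c : ℂ} {k : ℕ} {a b : ℝ}
    (hD : ContinuousOn D (Set.Icc a b)) (hL : ContinuousOn L (Set.Icc a b)) (hab : a ≤ b)
    (h : ∀ y ∈ Set.Icc a b, exp (D y) = c * exp (k * L y)) :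
    D b - D a = k * (L b - L a) := by
  let N : ℝ → ℂ := fun y => (D y - k * L y) / (2 * Real.pi * I)
  have hpi : (2 * Real.pi * I : ℂ) ≠ 0 := two_pi_I_ne_zero
  have hN : ContinuousOn N (Set.Icc a b) := by
    unfold N
    fun_prop (disch := assumption)
  have hexp : ∀ y ∈ Set.Icc a b, ∃ m : ℤ, N y - N a = m := fun y hy => by
    have ha := h a ⟨le_rfl, hab⟩
    have hy' := h y hy
    have : exp (D y - k * L y) = exp (D a - k * L a) := by
      rw [exp_sub, exp_sub, ha, hy', mul_div_cancel_right₀ _ (exp_ne_zero _),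
        mul_div_cancel_right₀ _ (exp_ne_zero _)]
    obtain ⟨m, hm⟩ := exp_eq_exp_iff_exists_int.1 this
    refine ⟨m, ?_⟩
    simp only [N, hm]
    field_simp
    ring
  have hconst : N b - N a = N a - N a := by
    have hpre : IsPreconnected (Set.Icc a b) := isPreconnected_Icc
    have hcont : ContinuousOn (fun y => (N y - N a).re) (Set.Icc a b) := by fun_prop
    have himg := hpre.image _ hcont
    obtain ⟨m, hm⟩ := hexp b ⟨hab, le_rfl⟩
    by_contra hne
    rw [sub_self] at hne
    have hm0 : m ≠ 0 := by
      rintro rfl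
      exact hne (by simpa using hm)
    have key : ∀ x ∈ (fun y => (N y - N a).re) '' Set.Icc a b, ∃ j : ℤ, x = j := by
      rintro _ ⟨y, hy, rfl⟩
      obtain ⟨j, hj⟩ := hexp y hy
      exact ⟨j, by simp [hj]⟩
    have h0 : (0 : ℝ) ∈ (fun y => (N y - N a).re) '' Set.Icc a b := ⟨a, ⟨le_rfl, hab⟩, by simp⟩
    have h1 : (m : ℝ) ∈ (fun y => (N y - N a).re) '' Set.Icc a b :=
      ⟨b, ⟨hab, le_rfl⟩, by simp [hm]⟩
    have hoc := himg.ordConnected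
    have half : ∃ x : ℝ, x ∈ (fun y => (N y - N a).re) '' Set.Icc a b ∧ (x = 1 / 2 ∨ x = - (1 / 2)) := by
      rcases lt_or_gt_of_ne hm0 with hlt | hgt
      · have : (m : ℝ) ≤ -1 := by exact_mod_cast Int.le_sub_one_of_lt hlt
        exact ⟨-(1 / 2), hoc.out h1 h0 ⟨by linarith, by norm_num⟩, Or.inr rfl⟩
      · have : (1 : ℝ) ≤ m := by exact_mod_cast hgt
        exact ⟨1 / 2, hoc.out h0 h1 ⟨by norm_num, by linarith⟩, Or.inl rfl⟩
    obtain ⟨x, hx, hx'⟩ := half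
    obtain ⟨j, rfl⟩ := key x hx
    rcases hx' with h | h
    · have : (2 * j : ℝ) = 1 := by linarith
      have : 2 * j = 1 := by exact_mod_cast this
      omega
    · have : (2 * j : ℝ) = -1 := by linarith
      have : 2 * j = -1 := by exact_mod_cast this
      omega
  have hfin : N b = N a := by simpa [sub_eq_zero] using hconst
  simp only [N] at hfin
  rw [div_left_inj' hpi] at hfin
  linear_combination hfin

/-- A doubly periodic function cannot have a single zero per period, of positive multiplicity. -/
theorem not_single_zero {P : ℂ → ℂ} (hP : Continuous P) (h1 : ∀ z, P (z + 1) = P z)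
    (hI : ∀ z, P (z + I) = P z) (p : ℂ) {k : ℕ} (hk : k ≠ 0) (hp : P p = 0)
    (h0 : ∀ z : ℂ, |z.re - p.re| ≤ 1 / 2 → |z.im - p.im| ≤ 1 / 2 → P z = 0 → z = p)
    {c : ℂ} (hc : c ≠ 0) (hlim : Tendsto (fun z => P z / (z - p) ^ k) (𝓝[≠] p) (𝓝 c)) : False := by
  obtain ⟨h, hh, hfac, hne⟩ := exists_factor (lin := fun a z => (z - a) ^ k)
    (fun a => by fun_prop) (fun a z => by simp [hk, sub_eq_zero]) {p} P hP fun a ha => by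
      obtain rfl := Finset.mem_singleton.1 ha
      exact ⟨hp, c, hc, hlim⟩
  simp only [Finset.prod_singleton] at hfac
  obtain ⟨H, hH, hhH⟩ := exists_log_on_square hh p (R := 1 / 2) (by norm_num) fun z hz1 hz2 hz => by
    have := h0 z hz1 hz2 (by rw [hfac, hz, zero_mul])
    subst this
    exact hne z (by simp) hz
  have hP' : ∀ x y : ℝ, |x| ≤ 1 / 2 → |y| ≤ 1 / 2 →
      P (p + (x + y * I)) = exp (H (p + (x + y * I))) * (x + y * I) ^ k := fun x y hx hy => by
    rw [hfac, hhH _ (by simpa using hx) (by simpa using hy)]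
    congr 2
    ring
  let L : ℝ → ℂ := fun y => log ((1 / 2 + y * I) / (1 / 2 - y * I))
  have hden : ∀ y : ℝ, (1 / 2 - y * I : ℂ) ≠ 0 := fun y hy => by
    have := congrArg re hy
    norm_num at this
  have hnum : ∀ y : ℝ, (1 / 2 + y * I : ℂ) ≠ 0 := fun y hy => by
    have := congrArg re hy
    norm_num at this
  have hslit : ∀ y : ℝ, y ∈ Set.Icc (-(1 / 2) : ℝ) (1 / 2) →
      ((1 / 2 + y * I) / (1 / 2 - y * I) : ℂ) ∈ slitPlane := fun y hy => by
    have hy2 : 0 < 1 / 4 + y ^ 2 := by positivity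
    have e : ((1 / 2 + y * I) / (1 / 2 - y * I) : ℂ) =
        ⟨(1 / 4 - y ^ 2) / (1 / 4 + y ^ 2), y / (1 / 4 + y ^ 2)⟩ := by
      rw [div_eq_iff (hden y)]
      apply Complex.ext
      · simp
        field_simp
        ring
      · simp
        field_simp
        ring
    rw [e, mem_slitPlane_iff]
    by_cases hy0 : y = 0
    · left
      simp [hy0]
    · right
      exact div_ne_zero hy0 hy2.ne'
  have hL : ContinuousOn L (Set.Icc (-(1 / 2)) (1 / 2)) := by
    refine ContinuousOn.clog ?_ hslit
    exact ContinuousOn.div (by fun_prop) (by fun_prop) fun y _ => hden y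
  have hexpL : ∀ y : ℝ, exp (k * L y) = ((1 / 2 + y * I) / (1 / 2 - y * I)) ^ k := fun y => by
    rw [exp_nat_mul, exp_log (div_ne_zero (hnum y) (hden y))]
  have hL1 : L (1 / 2) = Real.pi / 2 * I := by
    have : ((1 / 2 + (1 / 2 : ℝ) * I) / (1 / 2 - (1 / 2 : ℝ) * I) : ℂ) = I := by
      rw [div_eq_iff (hden _)]
      push_cast
      linear_combination (1 / 2) * I_sq
    simp only [L]
    rw [this, log_I]
  have hL2 : L (-(1 / 2)) = -(Real.pi / 2 * I) := by
    have : ((1 / 2 + (-(1 / 2) : ℝ) * I) / (1 / 2 - (-(1 / 2) : ℝ) * I) : ℂ) = -I := by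
      rw [div_eq_iff (hden _)]
      push_cast
      linear_combination (1 / 2) * I_sq
    simp only [L]
    rw [this, log_neg_I]
    ring
  have hhalf : |(1 / 2 : ℝ)| ≤ 1 / 2 := by norm_num [abs_le]
  have hhalf' : |(-(1 / 2) : ℝ)| ≤ 1 / 2 := by norm_num [abs_le]
  have hD := sub_eq_of_exp_eq (k := k) (c := (-1) ^ k) (L := L) (a := -(1 / 2)) (b := 1 / 2)
    (D := fun y => H (p + ((-(1 / 2) : ℝ) + y * I)) - H (p + ((1 / 2 : ℝ) + y * I)))
    (by fun_prop) hL (by norm_num) fun y hy => by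
      have hy' : |y| ≤ 1 / 2 := abs_le.2 hy
      have e := hP' (1 / 2) y hhalf hy'
      have e' := hP' (-(1 / 2)) y hhalf' hy'
      have e3 : p + (((1 / 2 : ℝ) : ℂ) + y * I) = p + (((-(1 / 2) : ℝ) : ℂ) + y * I) + 1 := by
        push_cast; ring
      have e4 := h1 (p + (((-(1 / 2) : ℝ) : ℂ) + y * I))
      rw [← e3, e, e'] at e4
      rw [hexpL, exp_sub, div_pow, ← mul_div_assoc, ← mul_pow, div_eq_div_iff (exp_ne_zero _)
        (pow_ne_zero _ (hden y))]
      have e5 : (-1 * (1 / 2 + y * I) : ℂ) ^ k = (-1) ^ k * (1 / 2 + y * I) ^ k := mul_pow _ _ _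
      have e6 : (1 / 2 - y * I : ℂ) ^ k = (-1) ^ k * (((-(1 / 2) : ℝ) : ℂ) + y * I) ^ k := by
        rw [← mul_pow]; congr 1; push_cast; ring
      rw [e5, e6]
      have e7 : ((1 / 2 : ℝ) + y * I : ℂ) = 1 / 2 + y * I := by push_cast; ring
      rw [e7] at e4 ⊢
      linear_combination (-(-1) ^ k) * e4
  have hE := sub_eq_of_exp_eq (k := k) (c := (-1) ^ k) (L := fun x => - L x) (a := -(1 / 2))
    (b := 1 / 2)
    (D := fun x => H (p + (x + (-(1 / 2) : ℝ) * I)) - H (p + (x + (1 / 2 : ℝ) * I)))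
    (by fun_prop) hL.neg (by norm_num) fun x hx => by
      have hx' : |x| ≤ 1 / 2 := abs_le.2 hx
      have e := hP' x (1 / 2) hx' hhalf
      have e' := hP' x (-(1 / 2)) hx' hhalf'
      have e3 : p + ((x : ℂ) + ((1 / 2 : ℝ) : ℂ) * I) = p + (x + ((-(1 / 2) : ℝ) : ℂ) * I) + I := by
        push_cast; ring
      have e4 := hI (p + (x + ((-(1 / 2) : ℝ) : ℂ) * I))
      rw [← e3, e, e'] at e4
      rw [mul_neg, exp_neg, hexpL, exp_sub, ← inv_pow, inv_div, div_pow, ← mul_div_assoc,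
        div_eq_div_iff (exp_ne_zero _) (pow_ne_zero _ (hnum x))]
      have hI2 : I ^ 2 = -1 := I_sq
      have e5 : (x + (1 / 2 : ℝ) * I : ℂ) ^ k = I ^ k * (1 / 2 - x * I) ^ k := by
        rw [← mul_pow]; congr 1; push_cast; linear_combination x * hI2
      have e6 : (x + (-(1 / 2) : ℝ) * I : ℂ) ^ k = I ^ k * ((-1) ^ k * (1 / 2 + x * I) ^ k) := by
        rw [← mul_pow, ← mul_pow]; congr 1; push_cast; linear_combination x * hI2
      rw [e5, e6] at e4
      have hIk : I ^ k ≠ 0 := pow_ne_zero _ I_ne_zero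
      have hs : ((-1 : ℂ) ^ k) ^ 2 = 1 := by rw [← pow_mul, mul_comm, pow_mul]; simp
      apply mul_left_cancel₀ hIk
      linear_combination (-(-1) ^ k) * e4 - I ^ k * exp (H (p + (x + (-(1 / 2) : ℝ) * I))) * (1 / 2 + x * I) ^ k * hs
  simp only [hL1, hL2] at hD hE
  have hfin : (k : ℂ) * (2 * Real.pi * I) = 0 := by linear_combination hE - hD
  have hk' : (k : ℂ) ≠ 0 := by exact_mod_cast hk
  exact mul_ne_zero hk' two_pi_I_ne_zero hfin

/-- The covering projection `ℂ → T²`. -/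
noncomputable def projC (z : ℂ) : Torus2 := ((z.re : Circ), (z.im : Circ))

theorem continuous_projC : Continuous projC :=
  ((AddCircle.continuous_mk' (1 : ℝ)).comp continuous_re).prodMk
    ((AddCircle.continuous_mk' (1 : ℝ)).comp continuous_im)

theorem projC_surjective : Function.Surjective projC := fun u => by
  obtain ⟨x, hx⟩ := QuotientAddGroup.mk_surjective u.1
  obtain ⟨y, hy⟩ := QuotientAddGroup.mk_surjective u.2
  exact ⟨⟨x, y⟩, Prod.ext hx hy⟩

theorem coe_circ_eq_iff {x y : ℝ} : (x : Circ) = (y : Circ) ↔ ∃ m : ℤ, x = y + m := by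
  rw [← sub_eq_zero, ← AddCircle.coe_sub, AddCircle.coe_eq_zero_iff]
  refine exists_congr fun m => ?_
  rw [zsmul_eq_mul, mul_one, eq_comm, sub_eq_iff_eq_add']

theorem projC_eq_iff {z w : ℂ} : projC z = projC w ↔ ∃ a b : ℤ, z = w + (a + b * I) := by
  simp only [projC, Prod.mk.injEq, coe_circ_eq_iff]
  constructor
  · rintro ⟨⟨a, ha⟩, b, hb⟩
    exact ⟨a, b, Complex.ext (by simpa using ha) (by simpa using hb)⟩
  · rintro ⟨a, b, rfl⟩
    exact ⟨⟨a, by simp⟩, b, by simp⟩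

theorem projC_add_int (z : ℂ) (a b : ℤ) : projC (z + (a + b * I)) = projC z :=
  projC_eq_iff.2 ⟨a, b, rfl⟩

/-- A continuous function on `ℝ` with integer values is constant. -/
theorem exists_eq_int {N : ℝ → ℝ} (hN : Continuous N) (h : ∀ t, ∃ m : ℤ, N t = m) :
    ∃ m : ℤ, ∀ t, N t = m := by
  choose m hm using h
  have hmc : Continuous m := by
    rw [Int.isClosedEmbedding_coe_real.isEmbedding.continuous_iff]
    exact hN.congr hm
  exact ⟨m 0, fun t => by rw [hm, PreconnectedSpace.constant inferInstance hmc (y := 0)]⟩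

theorem exists_lift_circ (ℓ : C(Circ, Circ)) : ∃ (g : ℝ → ℝ) (w : ℤ), Continuous g ∧
    (∀ t : ℝ, (g t : Circ) = ℓ t) ∧ ∀ t, g (t + 1) = g t + w := by
  have hcov : IsCoveringMap ((↑) : ℝ → Circ) := AddCircle.isCoveringMap_coe 1
  obtain ⟨x, hx⟩ := QuotientAddGroup.mk_surjective (ℓ ((0 : ℝ) : Circ))
  obtain ⟨g, ⟨-, hg⟩, -⟩ := hcov.existsUnique_continuousMap_lifts
    (A := ℝ) ⟨fun t : ℝ => ℓ (t : Circ), ℓ.continuous.comp (AddCircle.continuous_mk' 1)⟩ 0 x hx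
  have hg' : ∀ t : ℝ, (g t : Circ) = ℓ t := fun t => congrFun hg t
  have hint : ∀ t, ∃ m : ℤ, g (t + 1) - g t = m := fun t => by
    have h : ((g (t + 1) : ℝ) : Circ) = (g t : ℝ) := by
      rw [hg', hg', AddCircle.coe_add_period]
    obtain ⟨m, hm⟩ := coe_circ_eq_iff.1 h
    exact ⟨m, by linarith⟩
  obtain ⟨m, hm⟩ := exists_eq_int (by fun_prop) hint
  exact ⟨g, m, g.continuous, hg', fun t => by linarith [hm t]⟩

theorem exists_lift (ℓ : C(Circ, Torus2)) : ∃ (Γ : ℝ → ℂ) (a b : ℤ), Continuous Γ ∧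
    (∀ t : ℝ, projC (Γ t) = ℓ t) ∧ ∀ t, Γ (t + 1) = Γ t + (a + b * I) := by
  obtain ⟨g, a, hg, hgl, hga⟩ := exists_lift_circ ⟨fun x => (ℓ x).1, by fun_prop⟩
  obtain ⟨h, b, hh, hhl, hhb⟩ := exists_lift_circ ⟨fun x => (ℓ x).2, by fun_prop⟩
  refine ⟨fun t => g t + h t * I, a, b, by fun_prop, fun t => ?_, fun t => ?_⟩
  · exact Prod.ext (by simpa [projC] using hgl t) (by simpa [projC] using hhl t)
  · simp only [hga, hhb]
    push_cast
    ring

theorem nonzeroClass_of_lift {ℓ : C(Circ, Torus2)} {Γ : ℝ → ℂ} {a b : ℤ} (hΓ : Continuous Γ)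
    (h : ∀ t : ℝ, projC (Γ t) = ℓ t) (hp : ∀ t, Γ (t + 1) = Γ t + (a + b * I))
    (hab : ¬ (a = 0 ∧ b = 0)) : NonzeroClass ℓ := by
  refine ⟨fun t => ((Γ t).re, (Γ t).im), (a, b), (continuous_re.comp hΓ).prodMk
    (continuous_im.comp hΓ), h, fun t => ?_, fun h => hab (by simpa using h)⟩
  simp [hp]

/-- A continuous periodic function on `ℝ` descends to the circle. -/
theorem exists_descend {Y : Type*} [TopologicalSpace Y] {g : ℝ → Y} (hg : Continuous g)
    (hp : ∀ t, g (t + 1) = g t) : ∃ f : C(Circ, Y), ∀ t : ℝ, f (t : Circ) = g t := by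
  have hper : Function.Periodic g 1 := hp
  refine ⟨⟨hper.lift, continuous_coinduced_dom.2 ?_⟩, fun t => hper.lift_coe t⟩
  exact hg

theorem nullhomotopic_of_lift {ℓ : C(Circ, Torus2)} {Γ : ℝ → ℂ} (hΓ : Continuous Γ)
    (h : ∀ t : ℝ, projC (Γ t) = ℓ t) (hp : ∀ t, Γ (t + 1) = Γ t) : ℓ.Nullhomotopic := by
  obtain ⟨f, hf⟩ := exists_descend hΓ hp
  have : ℓ = (⟨projC, continuous_projC⟩ : C(ℂ, Torus2)).comp f := by
    ext1 x
    obtain ⟨t, rfl⟩ := QuotientAddGroup.mk_surjective x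
    exact (h t).symm.trans (congrArg projC (hf t).symm)
  rw [this]
  exact ((id_nullhomotopic ℂ).comp_left f).comp_right _

theorem lift_add_nat {Γ : ℝ → ℂ} {w : ℂ} (hp : ∀ t, Γ (t + 1) = Γ t + w) (t : ℝ) (n : ℕ) :
    Γ (t + n) = Γ t + n * w := by
  induction n with
  | zero => simp
  | succ n ih =>
    push_cast
    rw [← add_assoc, hp, ih]
    ring

theorem lift_add_int {Γ : ℝ → ℂ} {w : ℂ} (hp : ∀ t, Γ (t + 1) = Γ t + w) (t : ℝ) (n : ℤ) :
    Γ (t + n) = Γ t + n * w := by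
  obtain ⟨n, rfl | rfl⟩ := n.eq_nat_or_neg
  · exact_mod_cast lift_add_nat hp t n
  · have := lift_add_nat hp (t + (-n : ℤ)) n
    have e : t + ((-n : ℤ) : ℝ) + n = t := by push_cast; ring
    rw [e] at this
    rw [this]
    push_cast
    ring

theorem lift_unbounded {Γ : ℝ → ℂ} {w : ℂ} (hw : w ≠ 0) (hp : ∀ t, Γ (t + 1) = Γ t + w) (u : ℂ)
    (R : ℝ) : ∃ t, R < ‖Γ t + u‖ := by
  have hw' : 0 < ‖w‖ := norm_pos_iff.2 hw
  obtain ⟨n, hn⟩ := exists_nat_gt ((R + ‖Γ 0 + u‖) / ‖w‖)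
  rw [div_lt_iff₀ hw'] at hn
  refine ⟨0 + n, ?_⟩
  rw [lift_add_nat hp]
  have h1 : ‖(n * w : ℂ)‖ ≤ ‖Γ 0 + n * w + u‖ + ‖Γ 0 + u‖ := by
    have : (n * w : ℂ) = (Γ 0 + n * w + u) - (Γ 0 + u) := by ring
    calc ‖(n * w : ℂ)‖ = ‖(Γ 0 + n * w + u) - (Γ 0 + u)‖ := congrArg _ this
      _ ≤ _ := norm_sub_le _ _
  rw [norm_mul, Complex.norm_natCast] at h1
  linarith

/-- If the compact set `J` in the plane misses the preimage of a non-contractible loop `c` in the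
torus, then `z - a` has a logarithm on `J` for every point `a` above `c`. -/
theorem logOn_sub_of_loop {c : C(Circ, Torus2)} (hc : ¬ c.Nullhomotopic) {J : Set ℂ}
    (hJ : IsCompact J) (hd : ∀ z ∈ J, projC z ∉ Set.range c) {a : ℂ} (ha : projC a ∈ Set.range c) :
    LogOn J fun z => z - a := by
  obtain ⟨Γ, m, n, hΓ, hl, hp⟩ := exists_lift c
  obtain ⟨x, hx⟩ := ha
  obtain ⟨t, rfl⟩ := QuotientAddGroup.mk_surjective x
  have hw : (m + n * I : ℂ) ≠ 0 := fun h => hc (nullhomotopic_of_lift hΓ hl fun t => by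
    rw [hp, h, add_zero])
  obtain ⟨i, j, hij⟩ := projC_eq_iff.1 (hx.symm.trans (hl t).symm)
  rw [hij]
  refine logOn_sub_of_path (γ := fun t => Γ t + (i + j * I)) hJ (by fun_prop) (fun s hs => ?_)
    (lift_unbounded hw hp _) t
  refine hd _ hs ⟨(s : Circ), ?_⟩
  rw [projC_add_int, hl]

/-- If the `y`-coordinate of a lifted loop has nonzero increment, it takes every value. -/
theorem exists_im_eq {Γ : ℝ → ℂ} (hΓ : Continuous Γ) {a b : ℤ}
    (hp : ∀ t, Γ (t + 1) = Γ t + (a + b * I)) (hb : b ≠ 0) (y : ℝ) : ∃ t, (Γ t).im = y := by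
  have hval : ∀ n : ℤ, (Γ n).im = (Γ 0).im + n * b := fun n => by
    have := lift_add_int hp 0 n
    rw [zero_add] at this
    simp [this]
  obtain ⟨N, hN⟩ := exists_nat_gt |y - (Γ 0).im|
  have hb1 : (1 : ℝ) ≤ b * b := by
    have : 1 ≤ b * b := by nlinarith [mul_self_pos.2 hb]
    exact_mod_cast this
  have h1 : (Γ ((N * b : ℤ) : ℝ)).im = (Γ 0).im + N * (b * b) := by
    rw [hval]; push_cast; ring
  have h2 : (Γ ((-(N * b) : ℤ) : ℝ)).im = (Γ 0).im - N * (b * b) := by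
    rw [hval]; push_cast; ring
  have hN0 : (0 : ℝ) ≤ N := N.cast_nonneg
  have hN' := abs_lt.1 hN
  have h3 : (N : ℝ) ≤ N * (b * b) := le_mul_of_one_le_right hN0 hb1
  have := mem_range_of_exists_le_of_exists_ge (f := fun t => (Γ t).im) (c := y)
    (continuous_im.comp hΓ) ⟨_, (by rw [h2]; linarith)⟩ ⟨_, (by rw [h1]; linarith)⟩
  exact this

theorem exists_re_eq {Γ : ℝ → ℂ} (hΓ : Continuous Γ) {a b : ℤ}
    (hp : ∀ t, Γ (t + 1) = Γ t + (a + b * I)) (ha : a ≠ 0) (x : ℝ) : ∃ t, (Γ t).re = x := by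
  obtain ⟨t, ht⟩ := exists_im_eq (Γ := fun t => (Γ t).im + (Γ t).re * I) (a := b) (b := a)
    (by have := continuous_re; have := continuous_im; fun_prop)
    (fun t => by
      simp only [hp]
      simp
      ring) ha x
  exact ⟨t, by simpa using ht⟩

/-- `f` vanishes only at `p` and `q`, with a conformal zero at `p` and an anticonformal zero
at `q`. -/
def HasZeroPair (f : Torus2 → ℂ) (p q : Torus2) : Prop :=
  ∀ a : ℂ, f (projC a) = 0 →
    (projC a = p ∧ ∃ c ≠ 0, Tendsto (fun z => f (projC z) / (z - a)) (𝓝[≠] a) (𝓝 c)) ∨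
    (projC a = q ∧ ∃ c ≠ 0,
      Tendsto (fun z => f (projC z) / (starRingEnd ℂ) (z - a)) (𝓝[≠] a) (𝓝 c))

theorem tendsto_div_of_hasFDerivAt {F l : ℂ → ℂ} {L : ℂ →L[ℝ] ℂ} {a c : ℂ}
    (h : HasFDerivAt F L a) (h0 : F a = 0) (hl : ∀ z, ‖l z‖ = ‖z‖) (hL : ∀ z, L z = c * l z) :
    Tendsto (fun z => F z / l (z - a)) (𝓝[≠] a) (𝓝 c) := by
  have h1 : (fun z => F z - c * l (z - a)) =o[𝓝[≠] a] fun z => l (z - a) := by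
    have h2 := h.isLittleO.mono (nhdsWithin_le_nhds (s := {a}ᶜ))
    simp only [h0, sub_zero, hL] at h2
    exact h2.trans_isBigO (Asymptotics.IsBigO.of_bound 1 (by simp [hl]))
  have h3 := h1.tendsto_div_nhds_zero
  have h4 := h3.add_const c
  rw [zero_add] at h4
  refine h4.congr' ?_
  filter_upwards [self_mem_nhdsWithin] with z hz
  have : l (z - a) ≠ 0 := by
    rw [← norm_pos_iff, hl, norm_pos_iff]
    exact sub_ne_zero.2 hz
  field_simp
  ring

theorem toCircle_coe (x : ℝ) : ((AddCircle.toCircle (x : Circ) : Circle) : ℂ) =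
    (Real.cos (2 * Real.pi * x) : ℂ) + (Real.sin (2 * Real.pi * x) : ℂ) * I := by
  rw [AddCircle.toCircle_apply_mk, Circle.coe_exp, div_one, exp_mul_I]
  push_cast
  rfl

theorem coe_circ_eq_of_cos_sin {x y : ℝ} (hc : Real.cos (2 * Real.pi * x) = Real.cos (2 * Real.pi * y))
    (hs : Real.sin (2 * Real.pi * x) = Real.sin (2 * Real.pi * y)) : (x : Circ) = (y : Circ) := by
  apply AddCircle.injective_toCircle one_ne_zero
  apply Circle.ext
  rw [toCircle_coe, toCircle_coe, hc, hs]

theorem exists_hasZeroPair_of_im_eq {p q : ℂ} (him : p.im = q.im) (hpq : projC p ≠ projC q) :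
    ∃ f : C(Torus2, ℂ), f (projC p) = 0 ∧ HasZeroPair f (projC p) (projC q) := by
  let x₀ : ℝ := (p.re + q.re) / 2
  let s : ℝ := (q.re - p.re) / 2
  let C : ℝ := Real.cos (2 * Real.pi * s)
  let S : ℝ := Real.sin (2 * Real.pi * s)
  have hpre : p.re - x₀ = -s := by simp only [x₀, s]; ring
  have hqre : q.re - x₀ = s := by simp only [x₀, s]; ring
  have hS : S ≠ 0 := by
    intro h
    obtain ⟨n, hn⟩ := Real.sin_eq_zero_iff.1 h
    apply hpq
    rw [projC_eq_iff]
    refine ⟨-n, 0, Complex.ext ?_ (by simp [him])⟩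
    have : (n : ℝ) = 2 * s := by
      have := Real.pi_ne_zero
      field_simp at hn
      linarith
    simp [this, s]
    ring
  have hC : -1 < C := by
    have h1 := Real.sin_sq_add_cos_sq (2 * Real.pi * s)
    have h2 : 0 < S ^ 2 := by positivity
    change S ^ 2 + C ^ 2 = 1 at h1
    nlinarith
  let E : Circ → ℂ := fun u => ((AddCircle.toCircle u : Circle) : ℂ)
  have hE : Continuous E := continuous_subtype_val.comp AddCircle.continuous_toCircle
  have hEre : ∀ x : ℝ, (E (x : Circ)).re = Real.cos (2 * Real.pi * x) := fun x => by
    simp only [E, toCircle_coe, add_re, ofReal_re, re_ofReal_mul, I_re, mul_zero, add_zero]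
  have hEim : ∀ x : ℝ, (E (x : Circ)).im = Real.sin (2 * Real.pi * x) := fun x => by
    simp only [E, toCircle_coe, add_im, ofReal_im, im_ofReal_mul, I_im, mul_one, zero_add]
  have hre := continuous_re
  have him' := continuous_im
  let f : C(Torus2, ℂ) := ⟨fun u => (((E (u.1 - (x₀ : Circ))).re - C +
    ((E (u.2 - (p.im : Circ))).re - 1) : ℝ) : ℂ) + ((S * (E (u.2 - (p.im : Circ))).im : ℝ) : ℂ) * I,
    by fun_prop⟩
  have hf : ∀ z : ℂ, f (projC z) = ((Real.cos (2 * Real.pi * (z.re - x₀)) - C +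
      (Real.cos (2 * Real.pi * (z.im - p.im)) - 1) : ℝ) : ℂ) +
      ((S * Real.sin (2 * Real.pi * (z.im - p.im)) : ℝ) : ℂ) * I := fun z => by
    simp only [f, projC, ContinuousMap.coe_mk, ← AddCircle.coe_sub, hEre, hEim]
  refine ⟨f, ?_, fun a ha => ?_⟩
  · rw [hf, hpre, mul_neg, Real.cos_neg]
    simp [C]
  · have hfa := ha
    rw [hf] at ha
    have ha1 := congrArg re ha
    have ha2 := congrArg im ha
    simp only [add_re, ofReal_re, mul_re, I_re, mul_zero, ofReal_im, I_im, sub_self,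
      add_zero, zero_re, add_im, mul_im, mul_one, zero_add, zero_im, mul_eq_zero, hS,
      false_or] at ha1 ha2
    have hcy : Real.cos (2 * Real.pi * (a.im - p.im)) = 1 := by
      rcases Real.sin_eq_zero_iff_cos_eq.1 ha2 with h | h
      · exact h
      · have := Real.cos_le_one (2 * Real.pi * (a.re - x₀))
        rw [h] at ha1
        linarith
    have hcx : Real.cos (2 * Real.pi * (a.re - x₀)) = C := by
      rw [hcy] at ha1
      linarith
    have hy : (a.im : Circ) = (p.im : Circ) := by
      have : ((a.im - p.im : ℝ) : Circ) = ((0 : ℝ) : Circ) :=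
        coe_circ_eq_of_cos_sin (by simp [hcy]) (by simp [ha2])
      rwa [AddCircle.coe_sub, AddCircle.coe_zero, sub_eq_zero] at this
    have hsx : Real.sin (2 * Real.pi * (a.re - x₀)) = -S ∨
        Real.sin (2 * Real.pi * (a.re - x₀)) = S := by
      have h1 := Real.sin_sq_add_cos_sq (2 * Real.pi * (a.re - x₀))
      have h2 : S ^ 2 + C ^ 2 = 1 := Real.sin_sq_add_cos_sq (2 * Real.pi * s)
      rw [hcx] at h1
      exact (sq_eq_sq_iff_eq_or_eq_neg.1 (by linarith)).symm
    have hd1 : HasFDerivAt (fun z : ℂ => Real.cos (2 * Real.pi * (z.re - x₀)) - C +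
        (Real.cos (2 * Real.pi * (z.im - p.im)) - 1))
        ((-(2 * Real.pi * Real.sin (2 * Real.pi * (a.re - x₀)))) • reCLM) a := by
      have e1 : HasDerivAt (fun x => Real.cos (2 * Real.pi * (x - x₀)) - C)
          (-(2 * Real.pi * Real.sin (2 * Real.pi * (a.re - x₀)))) a.re := by
        have := ((((hasDerivAt_id a.re).sub_const x₀).const_mul (2 * Real.pi)).cos).sub_const C
        refine this.congr_deriv ?_
        simp
        ring
      have e2 : HasDerivAt (fun x => Real.cos (2 * Real.pi * (x - p.im)) - 1) 0 a.im := by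
        have := ((((hasDerivAt_id a.im).sub_const p.im).const_mul (2 * Real.pi)).cos).sub_const 1
        refine this.congr_deriv ?_
        simp [ha2]
      have := (e1.comp_hasFDerivAt a reCLM.hasFDerivAt).add (e2.comp_hasFDerivAt a imCLM.hasFDerivAt)
      rw [zero_smul, add_zero] at this
      exact this
    have hd2 : HasFDerivAt (fun z : ℂ => S * Real.sin (2 * Real.pi * (z.im - p.im)))
        ((S * (2 * Real.pi)) • imCLM) a := by
      have e2 : HasDerivAt (fun x => S * Real.sin (2 * Real.pi * (x - p.im))) (S * (2 * Real.pi))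
          a.im := by
        have := ((((hasDerivAt_id a.im).sub_const p.im).const_mul (2 * Real.pi)).sin).const_mul S
        refine this.congr_deriv ?_
        simp [hcy]
      exact e2.comp_hasFDerivAt a imCLM.hasFDerivAt
    have hd := (ofRealCLM.hasFDerivAt.comp a hd1).add
      ((ofRealCLM.hasFDerivAt.comp a hd2).mul_const I)
    have hd' : HasFDerivAt (fun z => f (projC z)) _ a := hd.congr_of_eventuallyEq
      (Eventually.of_forall fun z => hf z)
    have hcne : ((S * (2 * Real.pi) : ℝ) : ℂ) ≠ 0 := by
      exact_mod_cast mul_ne_zero hS Real.two_pi_pos.ne'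
    rcases hsx with hsx | hsx
    · left
      refine ⟨Prod.ext ?_ hy, ((S * (2 * Real.pi) : ℝ) : ℂ), hcne,
        tendsto_div_of_hasFDerivAt (l := fun z => z) hd' hfa (fun _ => rfl) fun z => ?_⟩
      · have : ((a.re - x₀ : ℝ) : Circ) = ((p.re - x₀ : ℝ) : Circ) :=
          coe_circ_eq_of_cos_sin (by rw [hcx, hpre, mul_neg, Real.cos_neg])
            (by rw [hsx, hpre, mul_neg, Real.sin_neg])
        rw [AddCircle.coe_sub, AddCircle.coe_sub] at this
        exact sub_left_inj.1 this
      · rw [hsx]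
        apply Complex.ext <;> simp
        first | ring1 | (left; ring1)
    · right
      refine ⟨Prod.ext ?_ (hy.trans (by rw [him]; rfl)), -((S * (2 * Real.pi) : ℝ) : ℂ),
        neg_ne_zero.2 hcne,
        tendsto_div_of_hasFDerivAt (l := fun z => (starRingEnd ℂ) z) hd' hfa
          (fun _ => RCLike.norm_conj _) fun z => ?_⟩
      · have : ((a.re - x₀ : ℝ) : Circ) = ((q.re - x₀ : ℝ) : Circ) :=
          coe_circ_eq_of_cos_sin (by rw [hcx, hqre]) (by rw [hsx, hqre])
        rw [AddCircle.coe_sub, AddCircle.coe_sub] at this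
        exact sub_left_inj.1 this
      · rw [hsx]
        apply Complex.ext <;> simp
        first | ring1 | (left; ring1)

/-- The reflection of the plane in the diagonal. -/
noncomputable def reflect (z : ℂ) : ℂ := I * (starRingEnd ℂ) z

theorem exists_hasZeroPair_of_re_eq {p q : ℂ} (hre : p.re = q.re) (hpq : projC p ≠ projC q) :
    ∃ f : C(Torus2, ℂ), f (projC p) = 0 ∧ HasZeroPair f (projC p) (projC q) := by
  have hproj : ∀ z, projC (reflect z) = (projC z).swap := fun z => by simp [projC, reflect]
  have hinv : ∀ z, reflect (reflect z) = z := fun z => by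
    apply Complex.ext <;> simp [reflect]
  have hcont : Continuous reflect := continuous_const.mul continuous_conj
  have hsub : ∀ z w, reflect z - reflect w = reflect (z - w) := fun z w => by
    simp [reflect, mul_sub]
  obtain ⟨f, hf0, hf⟩ := exists_hasZeroPair_of_im_eq (p := reflect p) (q := reflect q)
    (by simpa [reflect] using hre)
    (fun h => hpq (by rw [hproj, hproj] at h; exact Prod.swap_injective h))
  refine ⟨⟨fun u => (starRingEnd ℂ) (f u.swap), continuous_conj.comp
    (f.continuous.comp continuous_swap)⟩, ?_, fun a ha => ?_⟩
  · simp [← hproj, hf0]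
  · have htend : Tendsto reflect (𝓝[≠] a) (𝓝[≠] (reflect a)) :=
      tendsto_nhdsWithin_iff.2 ⟨(hcont.tendsto a).mono_left nhdsWithin_le_nhds, by
        filter_upwards [self_mem_nhdsWithin] with z hz h
        exact hz (by simpa [hinv] using congrArg reflect h)⟩
    have hne : ∀ c : ℂ, c ≠ 0 → (starRingEnd ℂ) c ≠ 0 := fun c hc => by simpa using hc
    rcases hf (reflect a) (by simpa [hproj] using ha) with ⟨h1, c, hc, hlim⟩ | ⟨h1, c, hc, hlim⟩
    · left
      refine ⟨by rw [hproj, hproj] at h1; exact Prod.swap_injective h1,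
        -I * (starRingEnd ℂ) c, mul_ne_zero (neg_ne_zero.2 I_ne_zero) (hne c hc), ?_⟩
      have := ((continuous_conj.tendsto c).comp (hlim.comp htend)).const_mul (-I)
      refine this.congr fun z => ?_
      simp only [Function.comp_apply, hsub, hproj, ContinuousMap.coe_mk, map_div₀]
      simp only [reflect, map_mul, conj_I, conj_conj]
      rw [← mul_div_assoc, mul_div_mul_left _ _ (neg_ne_zero.2 I_ne_zero)]
    · right
      refine ⟨by rw [hproj, hproj] at h1; exact Prod.swap_injective h1,
        I * (starRingEnd ℂ) c, mul_ne_zero I_ne_zero (hne c hc), ?_⟩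
      have := ((continuous_conj.tendsto c).comp (hlim.comp htend)).const_mul I
      refine this.congr fun z => ?_
      simp only [Function.comp_apply, hsub, hproj, ContinuousMap.coe_mk, map_div₀]
      simp only [reflect, map_mul, conj_I, map_neg, neg_neg, conj_conj]
      rw [← mul_div_assoc, mul_div_mul_left _ _ I_ne_zero]

theorem exists_log_of_null {f : C(Torus2, ℂ)} {p q : Torus2} (hf : HasZeroPair f p q)
    {c₁ c₂ : C(Circ, Torus2)} (hc₁ : ¬ c₁.Nullhomotopic) (hc₂ : ¬ c₂.Nullhomotopic)
    (hp : p ∈ Set.range c₁) (hq : q ∈ Set.range c₂) {ℓ : C(Circ, Torus2)} {γ : C(Circ, ℂ)}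
    (hγ : ∀ x, projC (γ x) = ℓ x) (hd₁ : ∀ x, ℓ x ∉ Set.range c₁)
    (hd₂ : ∀ x, ℓ x ∉ Set.range c₂) : ∃ g : C(Circ, ℂ), ∀ x, f (ℓ x) = exp (g x) := by
  have hJ : IsCompact (Set.range γ) := isCompact_range γ.continuous
  have h₁ : ∀ z ∈ Set.range γ, projC z ∉ Set.range c₁ := by
    rintro _ ⟨x, rfl⟩
    rw [hγ]
    exact hd₁ x
  have h₂ : ∀ z ∈ Set.range γ, projC z ∉ Set.range c₂ := by
    rintro _ ⟨x, rfl⟩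
    rw [hγ]
    exact hd₂ x
  have hlog : LogOn (Set.range γ) fun z => f (projC z) := by
    refine logOn_of_zeros (f.continuous.comp continuous_projC) hJ fun a ha => ?_
    rcases hf a ha with ⟨hap, hlim⟩ | ⟨haq, hlim⟩
    · exact ⟨fun z => z - a, by fun_prop, fun z => sub_eq_zero,
        logOn_sub_of_loop hc₁ hJ h₁ (hap ▸ hp), hlim⟩
    · exact ⟨fun z => (starRingEnd ℂ) (z - a), continuous_conj.comp (by fun_prop),
        fun z => by rw [map_eq_zero, sub_eq_zero],
        (logOn_sub_of_loop hc₂ hJ h₂ (haq ▸ hq)).conj, hlim⟩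
  obtain ⟨g, hg, hfg⟩ := hlog
  refine ⟨⟨fun x => g (γ x), hg.comp_continuous γ.continuous fun x => ⟨x, rfl⟩⟩, fun x => ?_⟩
  rw [← hγ]
  exact hfg _ ⟨x, rfl⟩

/-- If some coordinate `X` of a lift of `ℓ` has nonzero increment, a power of `F` acquires a
logarithm along `ℓ` after multiplication by a character of the torus. -/
theorem exists_twist_of_coord {X : ℂ → ℝ} (hX : Continuous X) {χ : C(Torus2, Circ)}
    (hχ : ∀ z, χ (projC z) = (X z : Circ)) {ℓ : C(Circ, Torus2)} {Γ : ℝ → ℂ} (hΓ : Continuous Γ)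
    (hl : ∀ t : ℝ, projC (Γ t) = ℓ t) {w : ℤ} (hw : w ≠ 0)
    (hXΓ : ∀ t, X (Γ (t + 1)) = X (Γ t) + w) {F : C(Torus2, ℂ)} (hF : ∀ x, F (ℓ x) ≠ 0) :
    ∃ (k : ℕ) (ε : C(Torus2, ℂ)) (A : C(ℂ, ℂ)), k ≠ 0 ∧ (∀ z, ε (projC z) = exp (A z)) ∧
      ∃ g : C(Circ, ℂ), ∀ x, F (ℓ x) ^ k * ε (ℓ x) = exp (g x) := by
  obtain ⟨g, hg, hFg⟩ := exists_continuous_log (f := fun t : ℝ => F (ℓ (t : Circ)))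
    (F.continuous.comp (ℓ.continuous.comp (AddCircle.continuous_mk' 1))) fun t => hF _
  have hint : ∀ t, ∃ m : ℤ, g (t + 1) = g t + m * (2 * Real.pi * I) := fun t => by
    rw [← Complex.exp_eq_exp_iff_exists_int, ← hFg, ← hFg]
    simp only [AddCircle.coe_add_period]
  have hpi : (2 * Real.pi * I : ℂ) ≠ 0 := Complex.two_pi_I_ne_zero
  obtain ⟨m, hm⟩ := exists_eq_int (N := fun t => ((g (t + 1) - g t) / (2 * Real.pi * I)).re)
    (by have := continuous_re; fun_prop) fun t => by
      obtain ⟨m, hm⟩ := hint t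
      refine ⟨m, ?_⟩
      rw [hm, add_sub_cancel_left, mul_div_cancel_right₀ _ hpi, intCast_re]
  have hgm : ∀ t, g (t + 1) = g t + m * (2 * Real.pi * I) := fun t => by
    obtain ⟨m', hm'⟩ := hint t
    have h := hm t
    rw [hm', add_sub_cancel_left, mul_div_cancel_right₀ _ hpi, intCast_re] at h
    rw [hm', Int.cast_injective h]
  let A : C(ℂ, ℂ) := ⟨fun z => ((-m * w : ℤ) : ℂ) * (2 * Real.pi * I) * X z, by fun_prop⟩
  let ε : C(Torus2, ℂ) := ⟨fun u => ((AddCircle.toCircle ((-m * w) • χ u) : Circle) : ℂ),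
    continuous_subtype_val.comp (AddCircle.continuous_toCircle.comp
      (χ.continuous.zsmul _))⟩
  have hε : ∀ z, ε (projC z) = exp (A z) := fun z => by
    simp only [ε, A, ContinuousMap.coe_mk, hχ]
    rw [← AddCircle.coe_zsmul, AddCircle.toCircle_apply_mk, Circle.coe_exp]
    congr 1
    simp
    ring
  have hkw : ((w.natAbs ^ 2 : ℕ) : ℂ) = (w : ℂ) ^ 2 := by
    have : ((w.natAbs ^ 2 : ℕ) : ℤ) = w ^ 2 := by simp
    rw [← Int.cast_natCast, this, Int.cast_pow]
  obtain ⟨G, hG⟩ := exists_descend (g := fun t => ((w.natAbs ^ 2 : ℕ) : ℂ) * g t + A (Γ t))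
    (by fun_prop) fun t => by
      simp only [A, ContinuousMap.coe_mk, hXΓ, hgm, hkw]
      push_cast
      ring
  refine ⟨w.natAbs ^ 2, ε, A, by positivity, hε, G, fun x => ?_⟩
  obtain ⟨t, rfl⟩ := QuotientAddGroup.mk_surjective x
  have h1 := hG t
  have h2 := hFg t
  have h3 := hε (Γ t)
  rw [hl] at h3
  change F (ℓ (t : Circ)) ^ _ * ε (ℓ (t : Circ)) = exp (G (t : Circ))
  rw [h1, exp_add, exp_nat_mul, h3]
  exact congrArg (fun y => y ^ _ * _) h2

theorem exists_twist {ℓ : C(Circ, Torus2)} {Γ : ℝ → ℂ} (hΓ : Continuous Γ)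
    (hl : ∀ t : ℝ, projC (Γ t) = ℓ t) {a b : ℤ} (hp : ∀ t, Γ (t + 1) = Γ t + (a + b * I))
    (hab : ¬ (a = 0 ∧ b = 0)) {F : C(Torus2, ℂ)} (hF : ∀ x, F (ℓ x) ≠ 0) :
    ∃ (k : ℕ) (ε : C(Torus2, ℂ)) (A : C(ℂ, ℂ)), k ≠ 0 ∧ (∀ z, ε (projC z) = exp (A z)) ∧
      ∃ g : C(Circ, ℂ), ∀ x, F (ℓ x) ^ k * ε (ℓ x) = exp (g x) := by
  by_cases ha : a = 0
  · exact exists_twist_of_coord continuous_im (χ := ⟨Prod.snd, continuous_snd⟩) (fun z => rfl)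
      hΓ hl (fun hb => hab ⟨ha, hb⟩) (fun t => by simp [hp]) hF
  · exact exists_twist_of_coord continuous_re (χ := ⟨Prod.fst, continuous_fst⟩) (fun z => rfl)
      hΓ hl ha (fun t => by simp [hp]) hF

/-- For disjoint loops, the first not contractible, there is a `HasZeroPair` function whose zeros
lie one on each loop. -/
theorem exists_hasZeroPair {c₁ c₂ : C(Circ, Torus2)} (hc₁ : ¬ c₁.Nullhomotopic)
    (hd : Disjoint (Set.range c₁) (Set.range c₂)) :
    ∃ (p : ℂ) (q : Torus2) (f : C(Torus2, ℂ)), projC p ∈ Set.range c₁ ∧ q ∈ Set.range c₂ ∧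
      f (projC p) = 0 ∧ HasZeroPair f (projC p) q := by
  obtain ⟨Γ, a, b, hΓ, hl, hp⟩ := exists_lift c₁
  obtain ⟨Δ, -, -, -, hl', -⟩ := exists_lift c₂
  have h₁ : ∀ t, projC (Γ t) ∈ Set.range c₁ := fun t => ⟨_, (hl t).symm⟩
  have h₂ : projC (Δ 0) ∈ Set.range c₂ := ⟨_, (hl' 0).symm⟩
  have hne : ∀ t, projC (Γ t) ≠ projC (Δ 0) := fun t h =>
    Set.disjoint_left.1 hd (h₁ t) (h ▸ h₂)
  by_cases hb : b = 0
  · have ha : a ≠ 0 := fun ha => hc₁ (nullhomotopic_of_lift hΓ hl fun t => by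
      rw [hp, ha, hb]; simp)
    obtain ⟨t, ht⟩ := exists_re_eq hΓ hp ha (Δ 0).re
    obtain ⟨f, hf0, hf⟩ := exists_hasZeroPair_of_re_eq ht (hne t)
    exact ⟨_, _, f, h₁ t, h₂, hf0, hf⟩
  · obtain ⟨t, ht⟩ := exists_im_eq hΓ hp hb (Δ 0).im
    obtain ⟨f, hf0, hf⟩ := exists_hasZeroPair_of_im_eq ht (hne t)
    exact ⟨_, _, f, h₁ t, h₂, hf0, hf⟩

/-- Logarithms on finitely many disjoint embedded loops extend to the whole torus. -/
theorem exists_common_extension {n : ℕ} {e : Fin n → C(Circ, Torus2)}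
    (hinj : ∀ i, Function.Injective (e i))
    (hpair : Pairwise fun i j => Disjoint (Set.range (e i)) (Set.range (e j)))
    (g : Fin n → C(Circ, ℂ)) : ∃ G : C(Torus2, ℂ), ∀ i x, G (e i x) = g i x := by
  let E : (Σ _ : Fin n, Circ) → Torus2 := fun s => e s.1 s.2
  have hE : Continuous E := continuous_sigma fun i => (e i).continuous
  have hEinj : Function.Injective E := by
    rintro ⟨i, x⟩ ⟨j, y⟩ h
    by_cases hij : i = j
    · subst hij
      rw [show x = y from hinj i h]
    · exact absurd ⟨y, h.symm⟩ (Set.disjoint_left.1 (hpair hij) ⟨x, rfl⟩)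
  obtain ⟨G, hG⟩ := ContinuousMap.exists_extension (hE.isClosedEmbedding hEinj)
    ⟨fun s => g s.1 s.2, continuous_sigma fun i => (g i).continuous⟩
  exact ⟨G, fun i x => DFunLike.congr_fun hG ⟨i, x⟩⟩

/-- A function on the torus with a logarithm on the frontier of `U` cannot have exactly one zero
in `U`, of conformal type. -/
theorem not_single_zero_of_frontier {U : Set Torus2} {Φ : C(Torus2, ℂ)} {G : C(Torus2, ℂ)}
    (hG : ∀ u ∈ frontier U, Φ u = exp (G u)) {p : ℂ} (hU : U ∈ 𝓝 (projC p))
    (h0 : Φ (projC p) = 0) (hz : ∀ u ∈ U, Φ u = 0 → u = projC p) {k : ℕ} (hk : k ≠ 0) {c : ℂ}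
    (hc : c ≠ 0) (hlim : Tendsto (fun z => Φ (projC z) / (z - p) ^ k) (𝓝[≠] p) (𝓝 c)) :
    False := by
  classical
  let Ψ : Torus2 → ℂ := U.piecewise Φ fun u => exp (G u)
  have hΨ : Continuous Ψ :=
    Continuous.piecewise hG Φ.continuous (continuous_exp.comp G.continuous)
  have hΨz : ∀ u, Ψ u = 0 → u = projC p := fun u hu => by
    by_cases h : u ∈ U
    · rw [show Ψ u = Φ u from Set.piecewise_eq_of_mem _ _ _ h] at hu
      exact hz u h hu
    · rw [show Ψ u = exp (G u) from Set.piecewise_eq_of_notMem _ _ _ h] at hu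
      exact absurd hu (exp_ne_zero _)
  have hper : ∀ (z : ℂ) (a b : ℤ), Ψ (projC (z + (a + b * I))) = Ψ (projC z) := fun z a b => by
    rw [projC_add_int]
  refine not_single_zero (P := fun z => Ψ (projC z)) (hΨ.comp continuous_projC)
    (fun z => by simpa using hper z 1 0) (fun z => by simpa using hper z 0 1) p hk ?_ ?_ hc
    (hlim.congr' ?_)
  · exact (Set.piecewise_eq_of_mem _ _ _ (mem_of_mem_nhds hU)).trans h0
  · intro z hre him hzz
    obtain ⟨a, b, rfl⟩ := projC_eq_iff.1 (hΨz _ hzz)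
    have key : ∀ m : ℤ, |(m : ℝ)| ≤ 1 / 2 → m = 0 := fun m hm => by
      have h1 : |m| < 1 := by
        have : |(m : ℝ)| < 1 := by linarith
        exact_mod_cast this
      exact Int.abs_lt_one_iff.1 h1
    have ha : a = 0 := key a (by simpa using hre)
    have hb : b = 0 := key b (by simpa using him)
    simp [ha, hb]
  · have : ∀ᶠ z in 𝓝[≠] p, projC z ∈ U :=
      nhdsWithin_le_nhds (continuous_projC.continuousAt hU)
    filter_upwards [this] with z hz
    rw [show Ψ (projC z) = Φ (projC z) from Set.piecewise_eq_of_mem _ _ _ hz]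

/-- If a regular bipartition `(X₁, X₂)` of `T²` admits loops `c₁ ⊆ X₁` and
`c₂ ⊆ X₂`, both non-contractible in `T²`, then the boundary `∂X₁` has at least two
components non-homologous to zero. -/
theorem stmt6 (X₁ X₂ : Set Torus2) (hX₁ : IsOpen X₁) (hX₂ : IsOpen X₂)
    (hdisj : Disjoint X₁ X₂) (hfront : frontier X₁ = frontier X₂)
    (hcover : X₁ ∪ X₂ ∪ frontier X₁ = Set.univ)
    (n : ℕ) (e : Fin n → C(Circ, Torus2))
    (hinj : ∀ i, Function.Injective (e i))
    (hpair : Pairwise fun i j => Disjoint (Set.range (e i)) (Set.range (e j)))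
    (hbd : frontier X₁ = ⋃ i, Set.range (e i))
    (c₁ c₂ : C(Circ, Torus2)) (hc₁ : Set.range c₁ ⊆ X₁) (hc₂ : Set.range c₂ ⊆ X₂)
    (hnc₁ : ¬c₁.Nullhomotopic) (hnc₂ : ¬c₂.Nullhomotopic) :
    ∃ i j : Fin n, i ≠ j ∧ NonzeroClass (e i) ∧ NonzeroClass (e j) := by
  by_contra hcon
  push Not at hcon
  choose Γ a b hΓ hl hper using fun i => exists_lift (e i)
  have huniq : ∀ i j, ¬ (a i = 0 ∧ b i = 0) → ¬ (a j = 0 ∧ b j = 0) → i = j := fun i j hi hj => by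
    by_contra hij
    exact hcon i j hij (nonzeroClass_of_lift (hΓ i) (hl i) (hper i) hi)
      (nonzeroClass_of_lift (hΓ j) (hl j) (hper j) hj)
  have hfr : ∀ i x, e i x ∈ frontier X₁ := fun i x => by
    rw [hbd]
    exact Set.mem_iUnion.2 ⟨i, x, rfl⟩
  have hd₁ : ∀ i x, e i x ∉ X₁ := fun i x h =>
    (hX₁.frontier_eq ▸ hfr i x : e i x ∈ closure X₁ \ X₁).2 h
  have hd₂ : ∀ i x, e i x ∉ X₂ := fun i x h =>
    Set.disjoint_left.1 (hdisj.closure_left hX₂) (frontier_subset_closure (hfr i x)) h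
  obtain ⟨p, q, f, hp, hq, hf0, hf⟩ := exists_hasZeroPair hnc₁ (hdisj.mono hc₁ hc₂)
  have hfe : ∀ i x, f (e i x) ≠ 0 := fun i x h => by
    obtain ⟨z, hz⟩ := projC_surjective (e i x)
    rw [← hz] at h
    rcases hf z h with ⟨h, -⟩ | ⟨h, -⟩
    · exact hd₁ i x (hc₁ (by rw [← hz, h]; exact hp))
    · exact hd₂ i x (hc₂ (by rw [← hz, h]; exact hq))
  have hnull : ∀ i, a i = 0 ∧ b i = 0 → ∃ γ : C(Circ, ℂ), (∀ x, projC (γ x) = e i x) ∧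
      ∃ g : C(Circ, ℂ), ∀ x, f (e i x) = exp (g x) := fun i hi => by
    obtain ⟨γ, hγ⟩ := exists_descend (hΓ i) fun t => by rw [hper, hi.1, hi.2]; simp
    have hγ' : ∀ x, projC (γ x) = e i x := fun x => by
      obtain ⟨t, rfl⟩ := QuotientAddGroup.mk_surjective x
      exact (congrArg projC (hγ t)).trans (hl i t)
    exact ⟨γ, hγ', exists_log_of_null hf hnc₁ hnc₂ hp hq hγ' (fun x h => hd₁ i x (hc₁ h))
      fun x h => hd₂ i x (hc₂ h)⟩
  obtain ⟨k, ε, A, hk, hε, hlog⟩ : ∃ (k : ℕ) (ε : C(Torus2, ℂ)) (A : C(ℂ, ℂ)), k ≠ 0 ∧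
      (∀ z, ε (projC z) = exp (A z)) ∧ ∀ i, ¬ (a i = 0 ∧ b i = 0) →
        ∃ g : C(Circ, ℂ), ∀ x, f (e i x) ^ k * ε (e i x) = exp (g x) := by
    by_cases h : ∃ i, ¬ (a i = 0 ∧ b i = 0)
    · obtain ⟨i, hi⟩ := h
      obtain ⟨k, ε, A, hk, hε, hg⟩ := exists_twist (hΓ i) (hl i) (hper i) hi (hfe i)
      exact ⟨k, ε, A, hk, hε, fun j hj => huniq i j hi hj ▸ hg⟩
    · exact ⟨1, 1, 0, one_ne_zero, by simp, fun i hi => absurd ⟨i, hi⟩ h⟩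
  have hlog' : ∀ i, ∃ g : C(Circ, ℂ), ∀ x, f (e i x) ^ k * ε (e i x) = exp (g x) := fun i => by
    by_cases hi : a i = 0 ∧ b i = 0
    · obtain ⟨γ, hγ, g, hg⟩ := hnull i hi
      refine ⟨⟨fun x => k * g x + A (γ x), by fun_prop⟩, fun x => ?_⟩
      change _ = exp (k * g x + A (γ x))
      rw [exp_add, exp_nat_mul, ← hg, ← hε, hγ]
    · exact hlog i hi
  choose g hg using hlog'
  obtain ⟨G, hG⟩ := exists_common_extension hinj hpair g
  have hpX : projC p ∈ X₁ := hc₁ hp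
  have hεz : ∀ u, ε u ≠ 0 := fun u => by
    obtain ⟨z, rfl⟩ := projC_surjective u
    rw [hε]
    exact exp_ne_zero _
  obtain ⟨c, hc, hlim⟩ : ∃ c ≠ 0, Tendsto (fun z => f (projC z) / (z - p)) (𝓝[≠] p) (𝓝 c) := by
    rcases hf p hf0 with ⟨-, h⟩ | ⟨h, -⟩
    · exact h
    · exact absurd (h ▸ hc₂ hq) (Set.disjoint_left.1 hdisj hpX)
  refine not_single_zero_of_frontier (U := X₁) (Φ := f ^ k * ε) (G := G) (fun u hu => ?_)
    (hX₁.mem_nhds hpX) (by simp [hf0, hk]) (fun u hu h => ?_) hk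
    (mul_ne_zero (pow_ne_zero k hc) (hεz (projC p))) ?_
  · rw [hbd] at hu
    obtain ⟨i, x, rfl⟩ := Set.mem_iUnion.1 hu
    rw [hG]
    exact hg i x
  · have hfu : f u = 0 := pow_eq_zero_iff hk |>.1 ((mul_eq_zero.1 h).resolve_right (hεz u))
    obtain ⟨z, rfl⟩ := projC_surjective u
    rcases hf z hfu with ⟨h, -⟩ | ⟨h, -⟩
    · exact h
    · exact absurd (h ▸ hc₂ hq) (Set.disjoint_left.1 hdisj hu)
  · have h1 := (hlim.pow k).mul (((ε.continuous.comp continuous_projC).tendsto p).mono_left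
      (nhdsWithin_le_nhds (s := {p}ᶜ)))
    refine h1.congr fun z => ?_
    simp only [Function.comp_apply, ContinuousMap.mul_apply, ContinuousMap.pow_apply, div_pow]
    ring
end
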